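/- arXiv:0902.3190 — 4 statements merged into one kernel-verified Lean document; each statement's English description precedes it below -/
import Mathlib

section
/- For every natural number p and every complex number s with Re s > p+1, the polynomial zeta function has the Abel–Plana representation ζ^{(p)}_P(s) = (1/2)·δ_{p,0}·a_0^{−s} + ∫_0^∞ x^p P(x)^{−s} dx + i ∫_0^∞ [ (ix)^p P(ix)^{−s} − (−ix)^p P(−ix)^{−s} ] · (e^{2πx} − 1)^{−1} dx, where δ_{p,0} is 1 if p = 0 and 0 otherwise. -/
/-- The polynomial `P(x) = aₙ xⁿ + ⋯ + a₁ x + a₀` evaluated at a real point. -/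
noncomputable def Pval (n : ℕ) (a : ℕ → ℝ) (x : ℝ) : ℝ :=
  ∑ i ∈ Finset.range (n + 1), a i * x ^ i

/-- For `Re z ≥ 0` (so that `Re (z - xᵢ) > 0`), the power
`P(z)^{−s} = exp(−s·log aₙ) · ∏ᵢ exp(−s·Log(z − xᵢ))`, with `Log` the principal branch. -/
noncomputable def Ppow (n : ℕ) (a : ℕ → ℝ) (x : Fin n → ℂ) (s z : ℂ) : ℂ :=
  Complex.exp (-s * (Real.log (a n) : ℂ)) *
    ∏ i : Fin n, Complex.exp (-s * Complex.log (z - x i))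

section AbelPlana

open MeasureTheory Set

lemma integrableOn_cpow_mul_cexp_neg {c u : ℂ} (hc : -1 < c.re) (hu : 0 < u.re) :
    IntegrableOn (fun t : ℝ => (t : ℂ) ^ c * Complex.exp (-(u * t))) (Ioi 0) := by
  have h := integrableOn_rpow_mul_exp_neg_mul_rpow hc one_pos hu
  refine Integrable.mono' h ?_ ?_
  · refine ContinuousOn.aestronglyMeasurable (fun t ht => ?_) measurableSet_Ioi
    have ht' : (t : ℂ) ∈ Complex.slitPlane := by
      exact Or.inl (by simpa using ht)
    refine ContinuousAt.continuousWithinAt ?_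
    refine ContinuousAt.mul ?_ (by fun_prop)
    exact (Complex.continuous_ofReal.continuousAt).cpow continuousAt_const ht'
  · filter_upwards [ae_restrict_mem measurableSet_Ioi] with t ht
    rw [norm_mul, Complex.norm_cpow_eq_rpow_re_of_pos ht, Complex.norm_exp]
    simp

lemma integral_cpow_mul_cexp_neg {a u : ℂ} (ha : 0 < a.re) (hu : 0 < u.re) :
    ∫ t in Ioi (0 : ℝ), (t : ℂ) ^ (a - 1) * Complex.exp (-(u * t)) =
      Complex.exp (-a * Complex.log u) * Complex.Gamma a := by
  set U : Set ℂ := {u | 0 < u.re} with hU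
  have hUo : IsOpen U := isOpen_lt continuous_const Complex.continuous_re
  have hUc : IsPreconnected U := (convex_halfSpace_re_gt 0).isPreconnected
  have hslit : ∀ u ∈ U, u ∈ Complex.slitPlane := fun u hu => Or.inl hu
  set F : ℂ → ℂ := fun u => ∫ t in Ioi (0 : ℝ), (t : ℂ) ^ (a - 1) * Complex.exp (-(u * t))
  have hF : DifferentiableOn ℂ F U := by
    intro v hv
    have hv : 0 < v.re := hv
    have ha1 : -1 < (a - 1).re := by simpa using ha
    have key := hasDerivAt_integral_of_dominated_loc_of_deriv_le
      (μ := volume.restrict (Ioi (0 : ℝ)))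
      (F := fun u t => (t : ℂ) ^ (a - 1) * Complex.exp (-(u * t)))
      (F' := fun u t => (t : ℂ) ^ (a - 1) * (Complex.exp (-(u * t)) * (-t)))
      (x₀ := v) (s := Metric.ball v (v.re / 2))
      (bound := fun t => t ^ a.re * Real.exp (-(v.re / 2) * t ^ (1 : ℝ)))
      (Metric.ball_mem_nhds _ (by positivity)) ?_
      (integrableOn_cpow_mul_cexp_neg ha1 hv) ?_ ?_ ?_ ?_
    · exact key.2.differentiableAt.differentiableWithinAt
    · filter_upwards [hUo.mem_nhds hv] with u hu
      exact (integrableOn_cpow_mul_cexp_neg ha1 hu).aestronglyMeasurable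
    · have h := (integrableOn_cpow_mul_cexp_neg ha1 hv).aestronglyMeasurable.mul
        (f := fun t : ℝ => (t : ℂ) ^ (a - 1) * Complex.exp (-(v * t))) (g := fun t : ℝ => -(t : ℂ))
        (by fun_prop)
      refine h.congr (Filter.Eventually.of_forall fun t => ?_)
      simp [mul_assoc]
    · filter_upwards [ae_restrict_mem measurableSet_Ioi] with t ht u hu
      have ht : 0 < t := ht
      have hre : v.re / 2 ≤ u.re := by
        have h1 := Complex.abs_re_le_norm (u - v)
        have h2 : ‖u - v‖ < v.re / 2 := by simpa [dist_eq_norm] using hu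
        have h3 := (abs_le.1 (h1.trans h2.le)).1
        simp at h3
        linarith
      rw [norm_mul, norm_mul, Complex.norm_cpow_eq_rpow_re_of_pos ht, Complex.norm_exp]
      simp only [Complex.sub_re, Complex.one_re, norm_neg, Complex.norm_real, Real.norm_eq_abs,
        abs_of_pos ht, Real.rpow_one]
      rw [Real.rpow_sub ht, Real.rpow_one]
      have : Real.exp (-(u * t)).re ≤ Real.exp (-(v.re / 2) * t) := by
        apply Real.exp_le_exp.2
        simp
        nlinarith
      calc _ = t ^ a.re * Real.exp (-(u * t)).re := by field_simp
        _ ≤ _ := by gcongr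
    · exact integrableOn_rpow_mul_exp_neg_mul_rpow (by linarith) one_pos (by positivity)
    · filter_upwards with t u hu
      have h1 : HasDerivAt (fun u : ℂ => -(u * (t : ℂ))) (-(t : ℂ)) u := by
        simpa using ((hasDerivAt_id u).mul_const (t : ℂ)).fun_neg
      exact (h1.cexp).const_mul _
  have hG : DifferentiableOn ℂ
      (fun u => Complex.exp (-a * Complex.log u) * Complex.Gamma a) U := by
    intro v hv
    have := hslit v hv
    exact ((((Complex.differentiableAt_log this).const_mul (-a)).cexp).mul_const
      _).differentiableWithinAt
  refine (hF.analyticOnNhd hUo).eqOn_of_preconnected_of_frequently_eq (hG.analyticOnNhd hUo) hUc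
    (z₀ := 1) (by simp [hU]) ?_ hu
  have hreal : ∀ r : ℝ, 0 < r → F r = Complex.exp (-a * Complex.log r) * Complex.Gamma a := by
    intro r hr
    change ∫ t in Ioi (0 : ℝ), (t : ℂ) ^ (a - 1) * Complex.exp (-(r * t)) = _
    rw [Complex.integral_cpow_mul_exp_neg_mul_Ioi ha hr]
    congr 1
    have hr0 : (r : ℂ) ≠ 0 := by exact_mod_cast hr.ne'
    rw [one_div, Complex.inv_cpow _ _ (by
        rw [Complex.arg_ofReal_of_nonneg hr.le]; exact Real.pi_pos.ne), ← Complex.cpow_neg,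
      Complex.cpow_def_of_ne_zero hr0, mul_comm]
  have htend : Filter.Tendsto (fun r : ℝ => (r : ℂ)) (nhdsWithin 1 {1}ᶜ)
      (nhdsWithin 1 {1}ᶜ) := by
    refine tendsto_nhdsWithin_of_tendsto_nhds_of_eventually_within _ ?_ ?_
    · exact_mod_cast (Complex.continuous_ofReal.tendsto (1 : ℝ)).mono_left nhdsWithin_le_nhds
    · filter_upwards [self_mem_nhdsWithin] with r hr
      simpa using hr
  refine htend.frequently (Filter.Eventually.frequently ?_)
  filter_upwards [nhdsWithin_le_nhds (Ioi_mem_nhds (zero_lt_one' ℝ))] with r hr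
  exact hreal r hr

/-- `g` is, on the closed right half-plane, a superposition `∫ w e^{-Tz}` of decaying exponentials,
with enough integrability to apply summation formulas termwise. -/
def IsExpSuperposition (g : ℂ → ℂ) : Prop :=
  ∃ (Ω : Type) (_ : MeasurableSpace Ω) (μ : Measure Ω) (_ : SFinite μ) (T : Ω → ℝ) (w : Ω → ℂ),
    Measurable T ∧ (∀ᵐ ω ∂μ, 0 < T ω) ∧ Integrable w μ ∧
    Integrable (fun ω => (T ω : ℂ) * w ω) μ ∧ Integrable (fun ω => ((T ω)⁻¹ : ℂ) * w ω) μ ∧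
    ∀ z : ℂ, 0 ≤ z.re → g z = ∫ ω, w ω * Complex.exp (-(T ω * z)) ∂μ

lemma IsExpSuperposition.mul {f g : ℂ → ℂ} (hf : IsExpSuperposition f)
    (hg : IsExpSuperposition g) : IsExpSuperposition (f * g) := by
  obtain ⟨Ω, _, μ, _, T, w, hT, hT0, hw, hTw, hwT, hfe⟩ := hf
  obtain ⟨Ω', _, ν, _, S, v, hS, hS0, hv, hSv, hvS, hge⟩ := hg
  have hT0' : ∀ᵐ q ∂(μ.prod ν), 0 < T q.1 := Measure.quasiMeasurePreserving_fst.ae hT0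
  have hS0' : ∀ᵐ q ∂(μ.prod ν), 0 < S q.2 := Measure.quasiMeasurePreserving_snd.ae hS0
  refine ⟨Ω × Ω', inferInstance, μ.prod ν, inferInstance, fun q => T q.1 + S q.2,
    fun q => w q.1 * v q.2, by fun_prop, ?_, hw.mul_prod hv, ?_, ?_, ?_⟩
  · filter_upwards [hT0', hS0'] with q h1 h2 using add_pos h1 h2
  · refine ((hTw.mul_prod hv).add (hw.mul_prod hSv)).congr (Filter.Eventually.of_forall fun q => ?_)
    simp only [Pi.add_apply, Complex.ofReal_add]
    ring
  · refine Integrable.mono (hwT.mul_prod hv) ?_ ?_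
    · refine AEStronglyMeasurable.mul ?_ (hw.mul_prod hv).aestronglyMeasurable
      exact (Measurable.inv (by fun_prop)).aestronglyMeasurable
    · filter_upwards [hT0', hS0'] with q h1 h2
      rw [← mul_assoc, norm_mul, norm_mul, norm_mul, norm_mul]
      gcongr
      rw [norm_inv, norm_inv, Complex.norm_real, Complex.norm_real, Real.norm_eq_abs,
        Real.norm_eq_abs, abs_of_pos h1, abs_of_pos (add_pos h1 h2)]
      gcongr
      linarith
  · intro z hz
    rw [Pi.mul_apply, hfe z hz, hge z hz, ← integral_prod_mul]
    refine integral_congr_ae (Filter.Eventually.of_forall fun q => ?_)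
    have : -((T q.1 + S q.2 : ℝ) * z) = -(T q.1 * z) + -(S q.2 * z) := by push_cast; ring
    simp only [this, Complex.exp_add]
    ring

lemma IsExpSuperposition.const_mul {f : ℂ → ℂ} (hf : IsExpSuperposition f) (c : ℂ) :
    IsExpSuperposition (fun z => c * f z) := by
  obtain ⟨Ω, _, μ, _, T, w, hT, hT0, hw, hTw, hwT, hfe⟩ := hf
  refine ⟨Ω, inferInstance, μ, inferInstance, T, fun ω => c * w ω, hT, hT0, hw.const_mul c,
    ?_, ?_, ?_⟩
  · exact (hTw.const_mul c).congr (Filter.Eventually.of_forall fun q => by ring)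
  · exact (hwT.const_mul c).congr (Filter.Eventually.of_forall fun q => by ring)
  · intro z hz
    simp only [hfe z hz, ← integral_const_mul]
    simp only [mul_assoc]

lemma IsExpSuperposition.congr {f g : ℂ → ℂ} (hf : IsExpSuperposition f)
    (hfg : ∀ z : ℂ, 0 ≤ z.re → g z = f z) : IsExpSuperposition g := by
  obtain ⟨Ω, _, μ, _, T, w, hT, hT0, hw, hTw, hwT, hfe⟩ := hf
  exact ⟨Ω, inferInstance, μ, inferInstance, T, w, hT, hT0, hw, hTw, hwT,
    fun z hz => (hfg z hz).trans (hfe z hz)⟩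

lemma isExpSuperposition_pow_mul_exp_log (p : ℕ) {s r : ℂ} (hs : (p : ℝ) + 1 < s.re)
    (hr : r.re < 0) :
    IsExpSuperposition (fun z => z ^ p * Complex.exp (-s * Complex.log (z - r))) := by
  set c : ℕ → ℂ := fun j => r ^ (p - j) * (p.choose j : ℂ) / Complex.Gamma (s - j) with hcdef
  have hjs : ∀ j ∈ Finset.range (p + 1), 1 < (s - j).re := by
    intro j hj
    have : (j : ℝ) ≤ p := by exact_mod_cast Finset.mem_range_succ_iff.1 hj
    simp
    linarith
  have hr' : 0 < (-r).re := by simpa using hr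
  have hint : ∀ d : ℂ, -2 ≤ d.re → IntegrableOn (fun t : ℝ => ∑ j ∈ Finset.range (p + 1),
      c j * ((t : ℂ) ^ (s - j + d) * Complex.exp (-(-r * t)))) (Ioi 0) := by
    intro d hd
    refine integrable_finsetSum _ fun j hj => ?_
    refine (integrableOn_cpow_mul_cexp_neg ?_ hr').const_mul (c j)
    have := hjs j hj
    rw [Complex.add_re]; linarith
  refine ⟨ℝ, inferInstance, volume.restrict (Ioi 0), inferInstance, id,
    fun t => ∑ j ∈ Finset.range (p + 1), c j * ((t : ℂ) ^ (s - j - 1) * Complex.exp (-(-r * t))),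
    measurable_id, ae_restrict_mem measurableSet_Ioi, ?_, ?_, ?_, ?_⟩
  · simpa only [sub_eq_add_neg, IntegrableOn] using hint (-1) (by simp)
  · refine (hint 0 (by simp)).congr ?_
    filter_upwards [ae_restrict_mem measurableSet_Ioi] with t ht
    have ht0 : (t : ℂ) ≠ 0 := by exact_mod_cast (ne_of_gt ht)
    rw [Finset.mul_sum]
    refine Finset.sum_congr rfl fun j _ => ?_
    rw [Complex.cpow_sub _ _ ht0, Complex.cpow_one, add_zero, id]
    field_simp
  · refine (hint (-1 - 1) (by norm_num)).congr ?_
    filter_upwards [ae_restrict_mem measurableSet_Ioi] with t ht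
    have ht0 : (t : ℂ) ≠ 0 := by exact_mod_cast (ne_of_gt ht)
    rw [Finset.mul_sum]
    refine Finset.sum_congr rfl fun j _ => ?_
    rw [Complex.cpow_sub _ _ ht0, Complex.cpow_one, ← add_sub_assoc, Complex.cpow_sub _ _ ht0,
      Complex.cpow_one, ← sub_eq_add_neg, Complex.cpow_sub _ _ ht0, Complex.cpow_one, id]
    field_simp
  · intro z hz
    have hzr : 0 < (z - r).re := by rw [Complex.sub_re]; linarith
    have hzr0 : z - r ≠ 0 := fun h => by simp [h] at hzr
    have e1 : ∀ t : ℝ, (∑ j ∈ Finset.range (p + 1), c j * ((t : ℂ) ^ (s - j - 1) *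
        Complex.exp (-(-r * t)))) * Complex.exp (-((id t : ℝ) * z)) =
        ∑ j ∈ Finset.range (p + 1), c j * ((t : ℂ) ^ (s - j - 1) *
          Complex.exp (-((z - r) * t))) := by
      intro t
      rw [Finset.sum_mul]
      refine Finset.sum_congr rfl fun j _ => ?_
      rw [show -((z - r) * t) = -(-r * t) + -((id t : ℝ) * z) by simp; ring, Complex.exp_add]
      ring
    simp only [e1]
    rw [integral_finsetSum]
    · have e2 : z ^ p =
          ∑ j ∈ Finset.range (p + 1), (z - r) ^ j * r ^ (p - j) * (p.choose j : ℂ) := by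
        rw [← add_pow]; ring
      rw [e2, Finset.sum_mul]
      refine Finset.sum_congr rfl fun j hj => ?_
      have hj' := hjs j hj
      rw [integral_const_mul, integral_cpow_mul_cexp_neg (by linarith) hzr]
      have hG : Complex.Gamma (s - j) ≠ 0 := Complex.Gamma_ne_zero_of_re_pos (by linarith)
      have e3 : Complex.exp (-(s - j) * Complex.log (z - r)) =
          (z - r) ^ j * Complex.exp (-s * Complex.log (z - r)) := by
        rw [show -(s - j) * Complex.log (z - r) = j * Complex.log (z - r) +
          -s * Complex.log (z - r) by ring, Complex.exp_add, Complex.exp_nat_mul,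
          Complex.exp_log hzr0]
      rw [e3, hcdef]
      field_simp
    · intro j hj
      have hj' := hjs j hj
      refine (integrableOn_cpow_mul_cexp_neg ?_ hzr).const_mul (c j)
      rw [Complex.sub_re, Complex.one_re]; linarith

lemma div_exp_sub_one_le {t : ℝ} (ht : 0 < t) :
    t / (Real.exp (2 * Real.pi * t) - 1) ≤ Real.exp (-Real.pi * t) := by
  have hpi : (1 : ℝ) < Real.pi := by linarith [Real.pi_gt_three]
  have h1 : Real.pi * t ≤ Real.sinh (Real.pi * t) := Real.self_le_sinh_iff.2 (by positivity)
  have h2 : Real.exp (2 * Real.pi * t) - 1 =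
      2 * Real.sinh (Real.pi * t) * Real.exp (Real.pi * t) := by
    rw [Real.sinh_eq, show 2 * Real.pi * t = Real.pi * t + Real.pi * t by ring, Real.exp_add]
    have : Real.exp (-(Real.pi * t)) * Real.exp (Real.pi * t) = 1 := by
      rw [← Real.exp_add]; simp
    linear_combination this
  have h3 : t ≤ 2 * Real.sinh (Real.pi * t) := by nlinarith
  rw [h2, div_le_iff₀ (mul_pos (ht.trans_le h3) (Real.exp_pos (Real.pi * t)))]
  calc t ≤ 2 * Real.sinh (Real.pi * t) := h3
    _ = Real.exp (-Real.pi * t) * (2 * Real.sinh (Real.pi * t) * Real.exp (Real.pi * t)) := by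
      have : Real.exp (-Real.pi * t) * Real.exp (Real.pi * t) = 1 := by
        rw [← Real.exp_add]; simp
      linear_combination (-2 * Real.sinh (Real.pi * t)) * this

lemma exp_two_pi_mul_sub_one_pos {t : ℝ} (ht : 0 < t) : 0 < Real.exp (2 * Real.pi * t) - 1 := by
  have : 0 < 2 * Real.pi * t := by positivity
  linarith [Real.add_one_lt_exp this.ne']

lemma integrableOn_div_exp_sub_one :
    IntegrableOn (fun t : ℝ => t / (Real.exp (2 * Real.pi * t) - 1)) (Ioi 0) := by
  refine Integrable.mono' (exp_neg_integrableOn_Ioi 0 Real.pi_pos) ?_ ?_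
  · exact (Measurable.div (by fun_prop) (by fun_prop)).aestronglyMeasurable
  · filter_upwards [ae_restrict_mem measurableSet_Ioi] with t ht
    have ht : 0 < t := ht
    rw [Real.norm_of_nonneg (div_nonneg ht.le (exp_two_pi_mul_sub_one_pos ht).le)]
    exact div_exp_sub_one_le ht

lemma norm_two_mul_sin_le {T t : ℝ} (hT : 0 < T) (ht : 0 < t) :
    ‖2 * Complex.sin (T * t)‖ ≤ 2 * (T * t) := by
  rw [← Complex.ofReal_mul, ← Complex.ofReal_sin, norm_mul, Complex.norm_real, Real.norm_eq_abs]
  have h : |Real.sin (T * t)| ≤ |T * t| := Real.abs_sin_le_abs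
  rw [abs_of_pos (by positivity : 0 < T * t)] at h
  simpa using h

lemma hasSum_exp_neg_succ {t : ℝ} (ht : 0 < t) :
    HasSum (fun m : ℕ => Real.exp (-(2 * Real.pi * (m + 1)) * t))
      (Real.exp (2 * Real.pi * t) - 1)⁻¹ := by
  have hlt : Real.exp (-(2 * Real.pi * t)) < 1 := by
    rw [Real.exp_lt_one_iff]; simp; positivity
  have h := (hasSum_geometric_of_lt_one (Real.exp_pos _).le hlt).mul_left
    (Real.exp (-(2 * Real.pi * t)))
  convert! h using 1
  · ext m
    rw [← Real.exp_nat_mul, ← Real.exp_add]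
    congr 1; ring
  · have := exp_two_pi_mul_sub_one_pos ht
    have h3 : 1 - Real.exp (-(2 * Real.pi * t)) ≠ 0 := by linarith
    rw [Real.exp_neg] at h3 ⊢
    have := Real.exp_pos (2 * Real.pi * t)
    field_simp

lemma integral_exp_neg_mul_two_mul_sin {T b : ℝ} (hb : 0 < b) :
    ∫ t in Ioi (0 : ℝ), (Real.exp (-b * t) : ℂ) * (2 * Complex.sin (T * t)) =
      Complex.I * (1 / (b + T * Complex.I) - 1 / (b - T * Complex.I)) := by
  have h1 : (-(b + T * Complex.I)).re < 0 := by simpa using hb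
  have h2 : (-(b - T * Complex.I)).re < 0 := by simpa using hb
  have e : ∀ t : ℝ, (Real.exp (-b * t) : ℂ) * (2 * Complex.sin (T * t)) =
      Complex.I * (Complex.exp (-(b + T * Complex.I) * t) -
        Complex.exp (-(b - T * Complex.I) * t)) := by
    intro t
    rw [show -(b + T * Complex.I) * t = (-b * t : ℂ) + -(T * t) * Complex.I by ring,
      show -(b - T * Complex.I) * t = (-b * t : ℂ) + (T * t) * Complex.I by ring,
      Complex.exp_add, Complex.exp_add, Complex.sin]
    push_cast
    ring
  simp only [e]
  rw [integral_const_mul, integral_sub (integrableOn_exp_mul_complex_Ioi h1 0)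
    (integrableOn_exp_mul_complex_Ioi h2 0), integral_exp_mul_complex_Ioi h1,
    integral_exp_mul_complex_Ioi h2]
  simp only [Complex.ofReal_zero, mul_zero, Complex.exp_zero, neg_div_neg_eq]

/-- The Abel–Plana integral of the exponential `z ↦ e^{-Tz}`. -/
lemma integral_two_mul_sin_div_exp_sub_one {T : ℝ} (hT : 0 < T) :
    ∫ t in Ioi (0 : ℝ), 2 * Complex.sin (T * t) / (Complex.exp (2 * Real.pi * t) - 1) =
      (1 - Complex.exp (-T))⁻¹ - 1 / 2 - (T : ℂ)⁻¹ := by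
  have hpi := Real.pi_pos
  have hpi0 : (Real.pi : ℂ) ≠ 0 := by exact_mod_cast hpi.ne'
  have hT0 : (T : ℂ) ≠ 0 := by exact_mod_cast hT.ne'
  have hs := hasSum_integral_of_dominated_convergence (μ := volume.restrict (Ioi (0 : ℝ)))
    (F := fun (m : ℕ) (t : ℝ) => (Real.exp (-(2 * Real.pi * (m + 1)) * t) : ℂ) *
      (2 * Complex.sin (T * t)))
    (f := fun t : ℝ => 2 * Complex.sin (T * t) / (Complex.exp (2 * Real.pi * t) - 1))
    (fun m t => Real.exp (-(2 * Real.pi * (m + 1)) * t) * (2 * (T * t))) ?_ ?_ ?_ ?_ ?_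
  · rw [← hs.tsum_eq]
    set x : ℂ := T * Complex.I / (2 * Real.pi) with hx
    have hxi : x ∈ Complex.integerComplement := by
      rintro ⟨k, hk⟩
      have := congrArg Complex.im hk
      have hx' : x = ((T / (2 * Real.pi) : ℝ) : ℂ) * Complex.I := by rw [hx]; push_cast; ring
      rw [hx'] at this
      rw [Complex.intCast_im, Complex.im_ofReal_mul, Complex.I_im, mul_one] at this
      have : 0 < T / (2 * Real.pi) := by positivity
      linarith
    have hterm : ∀ m : ℕ, ∫ t in Ioi (0 : ℝ), (Real.exp (-(2 * Real.pi * (m + 1)) * t) : ℂ) *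
        (2 * Complex.sin (T * t)) =
        Complex.I / (2 * Real.pi) * (1 / (x - (m + 1)) + 1 / (x + (m + 1))) := by
      intro m
      rw [integral_exp_neg_mul_two_mul_sin (by positivity)]
      have e1 : x - (m + 1) = -(((2 * Real.pi * (m + 1) : ℝ) : ℂ) - T * Complex.I) /
          (2 * Real.pi) := by
        rw [hx]; push_cast; field_simp; ring
      have e2 : x + (m + 1) = (((2 * Real.pi * (m + 1) : ℝ) : ℂ) + T * Complex.I) /
          (2 * Real.pi) := by
        rw [hx]; push_cast; field_simp; ring
      rw [e1, e2, one_div_div, one_div_div, div_neg]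
      field_simp
      ring
    rw [tsum_congr hterm, tsum_mul_left, ← cot_series_rep' hxi, Complex.cot_eq_exp_ratio,
      show 2 * Complex.I * (Real.pi * x) = -(T : ℂ) by
        rw [hx]; field_simp; rw [Complex.I_sq]]
    have h3 : 1 - Complex.exp (-(T : ℂ)) ≠ 0 := by
      rw [← Complex.ofReal_neg, ← Complex.ofReal_exp]
      have : Real.exp (-T) < 1 := by rw [Real.exp_lt_one_iff]; linarith
      exact_mod_cast (by linarith : 1 - Real.exp (-T) ≠ 0)
    rw [hx]
    field_simp
    ring
  · intro m
    exact (Continuous.aestronglyMeasurable (by fun_prop))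
  · intro m
    filter_upwards [ae_restrict_mem measurableSet_Ioi] with t ht
    rw [norm_mul, Complex.norm_real, Real.norm_of_nonneg (Real.exp_pos _).le]
    gcongr
    exact norm_two_mul_sin_le hT ht
  · filter_upwards [ae_restrict_mem measurableSet_Ioi] with t ht
    exact (hasSum_exp_neg_succ ht).summable.mul_right _
  · refine (integrableOn_div_exp_sub_one.const_mul (2 * T)).congr ?_
    filter_upwards [ae_restrict_mem measurableSet_Ioi] with t ht
    rw [((hasSum_exp_neg_succ ht).mul_right _).tsum_eq]
    ring
  · filter_upwards [ae_restrict_mem measurableSet_Ioi] with t ht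
    have := (Complex.hasSum_ofReal.2 (hasSum_exp_neg_succ ht)).mul_right (2 * Complex.sin (T * t))
    convert! this using 1
    push_cast
    rw [div_eq_mul_inv, mul_comm]

section Superposition

variable {Ω : Type*} [MeasurableSpace Ω] {μ : Measure Ω} {T : Ω → ℝ} {w : Ω → ℂ}

lemma integrable_mul_exp_neg (hT : Measurable T) (hT0 : ∀ᵐ ω ∂μ, 0 < T ω) (hw : Integrable w μ)
    {z : ℂ} (hz : 0 ≤ z.re) : Integrable (fun ω => w ω * Complex.exp (-(T ω * z))) μ := by
  refine Integrable.mono hw (hw.aestronglyMeasurable.mul ?_) ?_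
  · exact (Measurable.aestronglyMeasurable (by fun_prop))
  · filter_upwards [hT0] with ω h
    rw [norm_mul, Complex.norm_exp]
    refine mul_le_of_le_one_right (norm_nonneg _) ?_
    simp only [Real.exp_le_one_iff, Complex.neg_re, Complex.re_ofReal_mul, neg_nonpos]
    positivity

lemma integrable_mul_inv_one_sub_exp (hT : Measurable T) (hT0 : ∀ᵐ ω ∂μ, 0 < T ω)
    (hw : Integrable w μ) (hwT : Integrable (fun ω => ((T ω)⁻¹ : ℂ) * w ω) μ) :
    Integrable (fun ω => w ω * (1 - Complex.exp (-T ω))⁻¹) μ := by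
  refine Integrable.mono' (hw.norm.add hwT.norm) (hw.aestronglyMeasurable.mul ?_) ?_
  · exact (Measurable.inv (by fun_prop)).aestronglyMeasurable
  · filter_upwards [hT0] with ω h
    have h1 : Real.exp (-T ω) < 1 := by rw [Real.exp_lt_one_iff]; linarith
    have h2 : ‖(1 - Complex.exp (-T ω))⁻¹‖ = (1 - Real.exp (-T ω))⁻¹ := by
      rw [← Complex.ofReal_neg, ← Complex.ofReal_exp, norm_inv, ← Complex.ofReal_one,
        ← Complex.ofReal_sub, Complex.norm_real, Real.norm_of_nonneg (by linarith)]
    have h3 : (1 - Real.exp (-T ω))⁻¹ ≤ 1 + (T ω)⁻¹ := by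
      have h4 := Real.add_one_le_exp (T ω)
      have h5 : Real.exp (-T ω) * Real.exp (T ω) = 1 := by rw [← Real.exp_add]; simp
      rw [inv_le_iff_one_le_mul₀ (by linarith)]
      have h6 := Real.exp_pos (-T ω)
      have h7 : (1 + (T ω)⁻¹) = (T ω + 1) / T ω := by field_simp
      rw [h7, div_mul_eq_mul_div, le_div_iff₀ h]
      nlinarith
    rw [norm_mul, h2]
    simp only [Pi.add_apply, norm_mul, norm_inv, Complex.norm_real]
    rw [Real.norm_of_nonneg h.le]
    nlinarith [norm_nonneg (w ω)]

lemma tsum_integral_mul_exp_neg (hT : Measurable T) (hT0 : ∀ᵐ ω ∂μ, 0 < T ω)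
    (hw : Integrable w μ) (hwT : Integrable (fun ω => ((T ω)⁻¹ : ℂ) * w ω) μ) :
    ∑' k : ℕ, ∫ ω, w ω * Complex.exp (-(T ω * k)) ∂μ =
      ∫ ω, w ω * (1 - Complex.exp (-T ω))⁻¹ ∂μ := by
  have hgeom : ∀ t : ℝ, 0 < t → HasSum (fun k : ℕ => Complex.exp (-(t * k)))
      (1 - Complex.exp (-t))⁻¹ := by
    intro t ht
    have h1 : ‖Complex.exp (-(t : ℂ))‖ < 1 := by
      rw [Complex.norm_exp]; simpa using ht
    convert! hasSum_geometric_of_norm_lt_one h1 using 1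
    ext k
    rw [← Complex.exp_nat_mul]
    congr 1; ring
  have hgeomR : ∀ t : ℝ, 0 < t → HasSum (fun k : ℕ => Real.exp (-(t * k)))
      (1 - Real.exp (-t))⁻¹ := by
    intro t ht
    have := hgeom t ht
    rw [← Complex.hasSum_ofReal]
    push_cast
    exact this
  refine (hasSum_integral_of_dominated_convergence (ι := ℕ)
    (fun k ω => ‖w ω‖ * Real.exp (-(T ω * k))) ?_ ?_ ?_ ?_ ?_).tsum_eq
  · intro k
    exact (integrable_mul_exp_neg hT hT0 hw (by simp)).aestronglyMeasurable
  · intro k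
    filter_upwards with ω
    rw [norm_mul, Complex.norm_exp]
    simp
  · filter_upwards [hT0] with ω h
    exact (hgeomR _ h).summable.mul_left _
  · refine (integrable_mul_inv_one_sub_exp hT hT0 hw hwT).norm.congr ?_
    filter_upwards [hT0] with ω h
    have h1 : Real.exp (-T ω) < 1 := by rw [Real.exp_lt_one_iff]; linarith
    rw [((hgeomR _ h).mul_left _).tsum_eq, norm_mul, ← Complex.ofReal_neg, ← Complex.ofReal_exp,
      norm_inv, ← Complex.ofReal_one,
      ← Complex.ofReal_sub, Complex.norm_real, Real.norm_of_nonneg (by linarith)]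
  · filter_upwards [hT0] with ω h
    exact (hgeom _ h).mul_left _

lemma integral_integral_mul_exp_neg [SFinite μ] (hT : Measurable T) (hT0 : ∀ᵐ ω ∂μ, 0 < T ω)
    (hw : Integrable w μ) (hwT : Integrable (fun ω => ((T ω)⁻¹ : ℂ) * w ω) μ) :
    ∫ t in Ioi (0 : ℝ), ∫ ω, w ω * Complex.exp (-(T ω * t)) ∂μ =
      ∫ ω, ((T ω)⁻¹ : ℂ) * w ω ∂μ := by
  rw [← integral_integral_swap (f := fun ω (t : ℝ) => w ω * Complex.exp (-(T ω * t)))]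
  · refine integral_congr_ae ?_
    filter_upwards [hT0] with ω h
    have h1 : (-(T ω : ℂ)).re < 0 := by simpa using h
    simp only [← neg_mul]
    rw [integral_const_mul, integral_exp_mul_complex_Ioi h1]
    simp [mul_comm]
  · rw [integrable_prod_iff]
    · constructor
      · filter_upwards [hT0] with ω h
        have h1 : (-(T ω : ℂ)).re < 0 := by simpa using h
        simpa only [← neg_mul, Function.uncurry] using!
          (integrableOn_exp_mul_complex_Ioi h1 0).const_mul (w ω)
      · refine hwT.norm.congr ?_
        filter_upwards [hT0] with ω h
        have e : ∀ t : ℝ, ‖w ω * Complex.exp (-(T ω * t))‖ =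
            ‖w ω‖ * Real.exp ((-T ω) * t) := by
          intro t
          rw [norm_mul, Complex.norm_exp]; simp
        simp only [Function.uncurry, e]
        rw [integral_const_mul, integral_exp_mul_Ioi (by linarith)]
        simp [abs_of_pos h, mul_comm]
    · refine AEStronglyMeasurable.mul hw.aestronglyMeasurable.comp_fst ?_
      exact (Measurable.aestronglyMeasurable (by fun_prop))

lemma integral_integral_mul_sin_div [SFinite μ] (hT : Measurable T) (hT0 : ∀ᵐ ω ∂μ, 0 < T ω)
    (hw : Integrable w μ) (hTw : Integrable (fun ω => (T ω : ℂ) * w ω) μ) :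
    ∫ t in Ioi (0 : ℝ), ∫ ω, w ω *
        (2 * Complex.sin (T ω * t) / (Complex.exp (2 * Real.pi * t) - 1)) ∂μ =
      ∫ ω, w ω * ((1 - Complex.exp (-T ω))⁻¹ - 1 / 2 - (T ω : ℂ)⁻¹) ∂μ := by
  rw [← integral_integral_swap (f := fun ω (t : ℝ) => w ω *
        (2 * Complex.sin (T ω * t) / (Complex.exp (2 * Real.pi * t) - 1)))]
  · refine integral_congr_ae ?_
    filter_upwards [hT0] with ω h
    rw [integral_const_mul, integral_two_mul_sin_div_exp_sub_one h]
  · refine Integrable.mono' (hTw.norm.mul_prod (integrableOn_div_exp_sub_one.const_mul 2)) ?_ ?_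
    · refine AEStronglyMeasurable.mul hw.aestronglyMeasurable.comp_fst ?_
      exact (Measurable.div (by fun_prop) (by fun_prop)).aestronglyMeasurable
    · have h1 : ∀ᵐ q ∂(μ.prod (volume.restrict (Ioi (0 : ℝ)))), 0 < T q.1 :=
        Measure.quasiMeasurePreserving_fst.ae hT0
      have h2 : ∀ᵐ q ∂(μ.prod (volume.restrict (Ioi (0 : ℝ)))), q.2 ∈ Ioi (0 : ℝ) :=
        Measure.quasiMeasurePreserving_snd.ae (ae_restrict_mem measurableSet_Ioi)
      filter_upwards [h1, h2] with q hq1 hq2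
      have hE := exp_two_pi_mul_sub_one_pos hq2
      have hE' : ‖Complex.exp (2 * Real.pi * q.2) - 1‖ = Real.exp (2 * Real.pi * q.2) - 1 := by
        rw [show Complex.exp (2 * Real.pi * q.2) - 1 =
          ((Real.exp (2 * Real.pi * q.2) - 1 : ℝ) : ℂ) by push_cast; rfl, Complex.norm_real,
          Real.norm_of_nonneg hE.le]
      simp only [Function.uncurry]
      rw [norm_mul, norm_div, hE', norm_mul (T q.1 : ℂ), Complex.norm_real,
        Real.norm_of_nonneg hq1.le]
      calc _ ≤ ‖w q.1‖ * (2 * (T q.1 * q.2) / (Real.exp (2 * Real.pi * q.2) - 1)) := by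
            gcongr
            exact norm_two_mul_sin_le hq1 hq2
        _ = _ := by ring

end Superposition

/-- The Abel–Plana formula for superpositions of decaying exponentials. -/
theorem IsExpSuperposition.abel_plana {f : ℂ → ℂ} (hf : IsExpSuperposition f) :
    ∑' k : ℕ, f k = f 0 / 2 + (∫ t in Ioi (0 : ℝ), f t) +
      Complex.I * ∫ t in Ioi (0 : ℝ), (f (Complex.I * t) - f (-(Complex.I * t))) /
        (Complex.exp (2 * Real.pi * t) - 1) := by
  obtain ⟨Ω, _, μ, _, T, w, hT, hT0, hw, hTw, hwT, hfe⟩ := hf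
  have hsum : ∑' k : ℕ, f k = ∫ ω, w ω * (1 - Complex.exp (-T ω))⁻¹ ∂μ := by
    rw [← tsum_integral_mul_exp_neg hT hT0 hw hwT]
    exact tsum_congr fun k => hfe k (by simp)
  have hzero : f 0 = ∫ ω, w ω ∂μ := by
    rw [hfe 0 (by simp)]; simp
  have hint : ∫ t in Ioi (0 : ℝ), f t = ∫ ω, ((T ω)⁻¹ : ℂ) * w ω ∂μ := by
    rw [← integral_integral_mul_exp_neg hT hT0 hw hwT]
    refine setIntegral_congr_fun measurableSet_Ioi fun t ht => hfe t ?_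
    simpa using le_of_lt ht
  have himag : Complex.I * ∫ t in Ioi (0 : ℝ), (f (Complex.I * t) - f (-(Complex.I * t))) /
        (Complex.exp (2 * Real.pi * t) - 1) =
      ∫ ω, w ω * ((1 - Complex.exp (-T ω))⁻¹ - 1 / 2 - (T ω : ℂ)⁻¹) ∂μ := by
    rw [← integral_integral_mul_sin_div hT hT0 hw hTw, ← integral_const_mul]
    refine integral_congr_ae (Filter.Eventually.of_forall fun t => ?_)
    have h1 : 0 ≤ (Complex.I * t).re := by simp
    have h2 : 0 ≤ (-(Complex.I * t)).re := by simp
    simp only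
    rw [hfe _ h1, hfe _ h2, ← integral_sub (integrable_mul_exp_neg hT hT0 hw h1)
      (integrable_mul_exp_neg hT hT0 hw h2), ← integral_div, ← integral_const_mul]
    refine integral_congr_ae (Filter.Eventually.of_forall fun ω => ?_)
    simp only [Complex.sin]
    rw [show -(T ω * t : ℂ) * Complex.I = -(T ω * (Complex.I * t)) by ring,
      show (T ω * t : ℂ) * Complex.I = -(T ω * -(Complex.I * t)) by ring]
    ring
  have hinv := integrable_mul_inv_one_sub_exp hT hT0 hw hwT
  have e : ∀ ω, w ω * ((1 - Complex.exp (-T ω))⁻¹ - 1 / 2 - (T ω : ℂ)⁻¹) =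
      w ω * (1 - Complex.exp (-T ω))⁻¹ - w ω / 2 - (T ω : ℂ)⁻¹ * w ω := fun ω => by ring
  rw [hsum, hzero, hint, himag]
  have hsub : ∫ ω, (w ω * (1 - Complex.exp (-T ω))⁻¹ - w ω / 2 - (T ω : ℂ)⁻¹ * w ω) ∂μ =
      (∫ ω, w ω * (1 - Complex.exp (-T ω))⁻¹ ∂μ) - (∫ ω, w ω ∂μ) / 2 -
        ∫ ω, (T ω : ℂ)⁻¹ * w ω ∂μ := by
    rw [← integral_div, ← integral_sub hinv (hw.div_const 2)]
    exact integral_sub (hinv.sub (hw.div_const 2)) hwT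
  simp only [e]
  rw [hsub]
  ring

lemma isExpSuperposition_pow_mul_Ppow {n : ℕ} (hn : 1 ≤ n) (a : ℕ → ℝ) {x : Fin n → ℂ}
    (hre : ∀ i, (x i).re < 0) (p : ℕ) {s : ℂ} (hs : (p : ℝ) + 1 < s.re) :
    IsExpSuperposition (fun z => z ^ p * Ppow n a x s z) := by
  set i₀ : Fin n := ⟨0, hn⟩
  have hprod : IsExpSuperposition (∏ i : Fin n, fun z : ℂ =>
      z ^ (if i = i₀ then p else 0) * Complex.exp (-s * Complex.log (z - x i))) := by
    refine Finset.prod_induction_nonempty _ IsExpSuperposition (fun _ _ => .mul)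
      ⟨i₀, Finset.mem_univ _⟩ fun i _ => isExpSuperposition_pow_mul_exp_log _ ?_ (hre i)
    refine lt_of_le_of_lt ?_ hs
    split_ifs <;> simp
  refine (hprod.const_mul (Complex.exp (-s * (Real.log (a n) : ℂ)))).congr fun z _ => ?_
  rw [Finset.prod_apply, Finset.prod_mul_distrib, Finset.prod_pow_eq_pow_sum, Ppow]
  simp only [Finset.sum_ite_eq', Finset.mem_univ, if_true]
  ring

lemma map_conj_eq_of_real_coeff {n : ℕ} {a : ℕ → ℝ} (han : a n ≠ 0) {x : Fin n → ℂ}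
    (hfact : ∀ z : ℂ, (∑ i ∈ Finset.range (n + 1), (a i : ℂ) * z ^ i)
      = (a n : ℂ) * ∏ i : Fin n, (z - x i)) :
    Multiset.map (fun i => (starRingEnd ℂ) (x i)) Finset.univ.val =
      Multiset.map x Finset.univ.val := by
  have han' : (a n : ℂ) ≠ 0 := by exact_mod_cast han
  have heq : ∀ z : ℂ, ∏ i : Fin n, (z - (starRingEnd ℂ) (x i)) = ∏ i : Fin n, (z - x i) := by
    intro z
    refine mul_left_cancel₀ han' ?_
    rw [← hfact z]
    have := congrArg (starRingEnd ℂ) (hfact ((starRingEnd ℂ) z))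
    simp only [map_sum, map_mul, map_pow, map_prod, map_sub, Complex.conj_conj,
      Complex.conj_ofReal] at this
    exact this.symm
  have hpoly : (Multiset.map (fun b => Polynomial.X - Polynomial.C b)
        (Multiset.map (fun i => (starRingEnd ℂ) (x i)) Finset.univ.val)).prod =
      (Multiset.map (fun b => Polynomial.X - Polynomial.C b)
        (Multiset.map x Finset.univ.val)).prod := by
    refine Polynomial.funext fun z => ?_
    rw [Multiset.map_map, Multiset.map_map]
    change Polynomial.eval z (∏ i : Fin n, _) = Polynomial.eval z (∏ i : Fin n, _)
    simpa [Polynomial.eval_prod] using heq z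
  rw [← Polynomial.roots_multiset_prod_X_sub_C (Multiset.map _ _), hpoly,
    Polynomial.roots_multiset_prod_X_sub_C]

lemma sum_arg_sub_eq_zero {n : ℕ} {a : ℕ → ℝ} (han : a n ≠ 0) {x : Fin n → ℂ}
    (hfact : ∀ z : ℂ, (∑ i ∈ Finset.range (n + 1), (a i : ℂ) * z ^ i)
      = (a n : ℂ) * ∏ i : Fin n, (z - x i))
    (hre : ∀ i, (x i).re < 0) {t : ℝ} (ht : 0 ≤ t) :
    ∑ i : Fin n, Complex.arg (t - x i) = 0 := by
  have h := congrArg (fun m => (Multiset.map (fun b : ℂ => Complex.arg (t - b)) m).sum)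
    (map_conj_eq_of_real_coeff han hfact)
  simp only [Multiset.map_map] at h
  change ∑ i : Fin n, Complex.arg (t - (starRingEnd ℂ) (x i)) =
    ∑ i : Fin n, Complex.arg (t - x i) at h
  have h2 : ∀ i, Complex.arg (t - (starRingEnd ℂ) (x i)) = -Complex.arg (t - x i) := by
    intro i
    have hpos : 0 < (t - x i).re := by
      have := hre i
      rw [Complex.sub_re, Complex.ofReal_re]; linarith
    have hne : Complex.arg (t - x i) ≠ Real.pi := by
      intro hpi
      exact absurd (Complex.arg_eq_pi_iff.1 hpi).1 (by linarith)
    rw [show (t : ℂ) - (starRingEnd ℂ) (x i) = (starRingEnd ℂ) (t - x i) by simp,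
      Complex.arg_conj, if_neg hne]
  simp only [h2, Finset.sum_neg_distrib] at h
  linarith

lemma Ppow_ofReal {n : ℕ} {a : ℕ → ℝ} (han : 0 < a n) {x : Fin n → ℂ}
    (hfact : ∀ z : ℂ, (∑ i ∈ Finset.range (n + 1), (a i : ℂ) * z ^ i)
      = (a n : ℂ) * ∏ i : Fin n, (z - x i))
    (hre : ∀ i, (x i).re < 0) (s : ℂ) {t : ℝ} (ht : 0 ≤ t) :
    Ppow n a x s t = Complex.exp (-s * (Real.log (Pval n a t) : ℂ)) := by
  have hne : ∀ i, (t : ℂ) - x i ≠ 0 := by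
    intro i h0
    have h1 := congrArg Complex.re h0
    have := hre i
    rw [Complex.sub_re, Complex.ofReal_re, Complex.zero_re] at h1
    linarith
  set r : ℝ := Real.log (a n) + ∑ i : Fin n, Real.log ‖(t : ℂ) - x i‖
  have hlog : (Real.log (a n) : ℂ) + ∑ i : Fin n, Complex.log (t - x i) = (r : ℂ) := by
    apply Complex.ext
    · simp [r, Complex.log_re]
    · simpa [Complex.log_im] using sum_arg_sub_eq_zero han.ne' hfact hre ht
  have hval : Real.exp r = Pval n a t := by
    have : Complex.exp r = (Pval n a t : ℂ) := by
      rw [← hlog, Complex.exp_add, Complex.exp_sum, ← Complex.ofReal_exp, Real.exp_log han,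
        Finset.prod_congr rfl fun i _ => Complex.exp_log (hne i), ← hfact, Pval]
      push_cast
      rfl
    exact_mod_cast this
  rw [← hval, Real.log_exp, ← hlog, mul_add, Complex.exp_add, Finset.mul_sum, Complex.exp_sum,
    Ppow]

end AbelPlana

/-- Abel–Plana representation of the polynomial zeta function: for `Re s > p + 1`,
`ζ^{(p)}_P(s) = ½ δ_{p,0} a₀^{−s} + ∫₀^∞ xᵖ P(x)^{−s} dx
  + i ∫₀^∞ [(ix)ᵖ P(ix)^{−s} − (−ix)ᵖ P(−ix)^{−s}]/(e^{2πx} − 1) dx`. -/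
theorem polynomial_zeta_abel_plana
    (n : ℕ) (hn : 1 ≤ n) (a : ℕ → ℝ) (han : 0 < a n) (ha0 : a 0 ≠ 0)
    (x : Fin n → ℂ)
    (hfact : ∀ z : ℂ, (∑ i ∈ Finset.range (n + 1), (a i : ℂ) * z ^ i)
      = (a n : ℂ) * ∏ i : Fin n, (z - x i))
    (hre : ∀ i, (x i).re < 0)
    (p : ℕ) (s : ℂ) (hs : (p : ℝ) + 1 < s.re) :
    (∑' k : ℕ, (k : ℂ) ^ p * Complex.exp (-s * (Real.log (Pval n a k) : ℂ)))
      = (if p = 0 then Complex.exp (-s * (Real.log (a 0) : ℂ)) / 2 else 0)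
        + (∫ t in Set.Ioi (0 : ℝ), (t : ℂ) ^ p * Ppow n a x s t)
        + Complex.I * ∫ t in Set.Ioi (0 : ℝ),
            ((Complex.I * t) ^ p * Ppow n a x s (Complex.I * t)
              - (-(Complex.I * t)) ^ p * Ppow n a x s (-(Complex.I * t)))
            / (Complex.exp (2 * (Real.pi : ℂ) * t) - 1) := by
  have hP : ∀ t : ℝ, 0 ≤ t → Complex.exp (-s * (Real.log (Pval n a t) : ℂ)) = Ppow n a x s t :=
    fun t ht => (Ppow_ofReal han hfact hre s ht).symm
  have h := (isExpSuperposition_pow_mul_Ppow hn a hre p hs).abel_plana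
  have hsum : ∀ k : ℕ, (k : ℂ) ^ p * Complex.exp (-s * (Real.log (Pval n a k) : ℂ)) =
      (k : ℂ) ^ p * Ppow n a x s k := fun k => by
    rw [hP k (Nat.cast_nonneg k)]; norm_cast
  have hzero : (if p = 0 then Complex.exp (-s * (Real.log (a 0) : ℂ)) / 2 else 0) =
      (0 : ℂ) ^ p * Ppow n a x s 0 / 2 := by
    have h0 : Pval n a 0 = a 0 := by
      simp [Pval, Finset.sum_range_succ']
    have h1 := hP 0 le_rfl
    rw [h0, Complex.ofReal_zero] at h1
    split_ifs with hp
    · rw [h1, hp, pow_zero, one_mul]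
    · simp [hp]
  rw [tsum_congr hsum, hzero, h]
end

section
/- Let x_0 be a complex number with Re x_0 < 0, let p be a natural number, and let s be a complex number with Re s > p + 1. Then ∫_0^∞ x^p (x − x_0)^{−s} dx = (Γ(s − p − 1) · p! / Γ(s)) · (−x_0)^{p+1−s}, where (x − x_0)^{−s} and (−x_0)^{p+1−s} are defined via the principal branch of the complex logarithm (applicable since Re(x − x_0) > 0 and Re(−x_0) > 0), and Γ is the complex Gamma function. -/
open Set MeasureTheory Filter Topology

/-- Pointwise bound for `tᵖ (t + w)^{-s}` by a real power of `t + Re w`. -/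
lemma norm_pow_mul_add_cpow_le {w s : ℂ} (hw : 0 < w.re) (hs : 0 ≤ s.re) (p : ℕ) {t : ℝ}
    (ht : 0 < t) :
    ‖(t : ℂ) ^ p * (t + w) ^ (-s)‖ ≤
      Real.exp (Real.pi * |s.im|) * (t + w.re) ^ ((p : ℝ) - s.re) := by
  have hpos : 0 < t + w.re := by positivity
  have hne : (t : ℂ) + w ≠ 0 := fun h ↦ by
    have := congrArg Complex.re h
    simp at this
    linarith
  have hre : t + w.re ≤ ‖(t : ℂ) + w‖ := by
    simpa using Complex.re_le_norm ((t : ℂ) + w)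
  have hcpow : ‖((t : ℂ) + w) ^ (-s)‖ ≤
      (t + w.re) ^ (-s.re) * Real.exp (Real.pi * |s.im|) := by
    rw [Complex.norm_cpow_of_ne_zero hne, div_eq_mul_inv, ← Real.exp_neg]
    gcongr ?_ * Real.exp ?_
    · exact Real.rpow_le_rpow_of_nonpos hpos hre (by simpa using hs)
    · calc -(Complex.arg (t + w) * (-s).im) ≤ |Complex.arg (t + w) * s.im| := by
            simpa using le_abs_self (Complex.arg (t + w) * s.im)
        _ ≤ Real.pi * |s.im| := by
            rw [abs_mul]
            gcongr
            exact Complex.abs_arg_le_pi _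
  calc ‖(t : ℂ) ^ p * (t + w) ^ (-s)‖ = t ^ p * ‖((t : ℂ) + w) ^ (-s)‖ := by
        simp [abs_of_pos ht]
    _ ≤ (t + w.re) ^ p * ((t + w.re) ^ (-s.re) * Real.exp (Real.pi * |s.im|)) := by
        gcongr
        linarith
    _ = _ := by
        rw [sub_eq_add_neg, Real.rpow_add hpos, Real.rpow_natCast]
        ring

lemma add_mem_slitPlane {w : ℂ} (hw : 0 < w.re) {t : ℝ} (ht : 0 ≤ t) :
    (t : ℂ) + w ∈ Complex.slitPlane :=
  Or.inl (by simpa using add_pos_of_nonneg_of_pos ht hw)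

lemma continuousOn_pow_mul_add_cpow {w : ℂ} (hw : 0 < w.re) (s : ℂ) (p : ℕ) :
    ContinuousOn (fun t : ℝ ↦ (t : ℂ) ^ p * (t + w) ^ s) (Ici 0) := by
  refine ContinuousOn.mul (by fun_prop) (ContinuousOn.cpow_const (by fun_prop) ?_)
  exact fun t ht ↦ add_mem_slitPlane hw ht

lemma integrableOn_pow_mul_add_cpow {w s : ℂ} (hw : 0 < w.re) {p : ℕ}
    (hs : (p : ℝ) + 1 < s.re) :
    IntegrableOn (fun t : ℝ ↦ (t : ℂ) ^ p * (t + w) ^ (-s)) (Ioi 0) := by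
  have hp : (0 : ℝ) ≤ p := p.cast_nonneg
  have hint : IntegrableOn (fun t : ℝ ↦ Real.exp (Real.pi * |s.im|) *
      (t + w.re) ^ ((p : ℝ) - s.re)) (Ioi 0) :=
    (integrableOn_add_rpow_Ioi_of_lt (by linarith) (by linarith)).const_mul _
  refine hint.mono' (((continuousOn_pow_mul_add_cpow hw (-s) p).mono
    Ioi_subset_Ici_self).aestronglyMeasurable measurableSet_Ioi) ?_
  filter_upwards [ae_restrict_mem measurableSet_Ioi] with t ht
  exact norm_pow_mul_add_cpow_le hw (by linarith) p ht

lemma tendsto_pow_mul_add_cpow_atTop {w s : ℂ} (hw : 0 < w.re) {p : ℕ} (hs : (p : ℝ) < s.re) :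
    Tendsto (fun t : ℝ ↦ (t : ℂ) ^ p * (t + w) ^ (-s)) atTop (𝓝 0) := by
  have hp : (0 : ℝ) ≤ p := p.cast_nonneg
  have hlim : Tendsto (fun t : ℝ ↦ Real.exp (Real.pi * |s.im|) *
      (t + w.re) ^ ((p : ℝ) - s.re)) atTop (𝓝 0) := by
    have := ((tendsto_rpow_neg_atTop (sub_pos.2 hs)).comp
      (tendsto_atTop_add_const_right atTop w.re tendsto_id)).const_mul
        (Real.exp (Real.pi * |s.im|))
    simpa using this
  refine squeeze_zero_norm' ?_ hlim
  filter_upwards [eventually_gt_atTop 0] with t ht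
  exact norm_pow_mul_add_cpow_le hw (by linarith) p ht

lemma hasDerivAt_add_cpow_div {w s : ℂ} (hw : 0 < w.re) (hs : s ≠ 1) {t : ℝ} (ht : 0 ≤ t) :
    HasDerivAt (fun t : ℝ ↦ ((t : ℂ) + w) ^ (-(s - 1)) / (1 - s)) ((t + w) ^ (-s)) t := by
  have hne : 1 - s ≠ 0 := sub_ne_zero.2 hs.symm
  have h := (((hasDerivAt_id (t : ℂ)).add_const w).cpow_const (c := -(s - 1))
    (add_mem_slitPlane hw ht)).div_const (1 - s)
  refine h.comp_ofReal.congr_deriv ?_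
  rw [show -(s - 1) - 1 = -s by ring]
  simp only [id]
  field_simp
  ring

/-- The Mellin-type integral `∫₀^∞ tᵖ (t + w)^{-s} dt` for `Re w > 0` and `Re s > p + 1`. -/
lemma integral_pow_mul_add_cpow {w : ℂ} (hw : 0 < w.re) (p : ℕ) (s : ℂ)
    (hs : (p : ℝ) + 1 < s.re) :
    ∫ t in Ioi (0 : ℝ), (t : ℂ) ^ p * (t + w) ^ (-s) =
      Complex.Gamma (s - p - 1) * p.factorial / Complex.Gamma s * w ^ (p + 1 - s) := by
  induction p generalizing s with
  | zero =>
    have hs1 : 1 < s.re := by simpa using hs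
    have hne : s ≠ 1 := by rintro rfl; simp at hs1
    have hne' : s - 1 ≠ 0 := sub_ne_zero.2 hne
    have hΓ : Complex.Gamma s = (s - 1) * Complex.Gamma (s - 1) := by
      simpa using Complex.Gamma_add_one (s - 1) hne'
    have hΓ0 : Complex.Gamma (s - 1) ≠ 0 :=
      Complex.Gamma_ne_zero_of_re_pos (by simpa using hs1)
    have hlim := (tendsto_pow_mul_add_cpow_atTop (s := s - 1) (p := 0) hw
      (by simpa using hs1)).div_const (1 - s)
    have h := integral_Ioi_of_hasDerivAt_of_tendsto'
      (fun t ht ↦ hasDerivAt_add_cpow_div hw hne (mem_Ici.1 ht))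
      (by simpa using integrableOn_pow_mul_add_cpow hw hs) (by simpa using hlim)
    simp only [pow_zero, one_mul, h, hΓ]
    have : 1 - s ≠ 0 := sub_ne_zero.2 hne.symm
    simp only [Complex.ofReal_zero, zero_add, Nat.cast_zero, sub_zero, Nat.factorial_zero,
      Nat.cast_one, neg_sub]
    field_simp
    ring
  | succ p ih =>
    have hp : (0 : ℝ) ≤ p := p.cast_nonneg
    push_cast at hs
    have hs' : (p : ℝ) + 1 < (s - 1).re := by simp; linarith
    have hne : s ≠ 1 := by rintro rfl; simp at hs; linarith
    have hne' : s - 1 ≠ 0 := sub_ne_zero.2 hne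
    have hne'' : 1 - s ≠ 0 := sub_ne_zero.2 hne.symm
    have hΓ : Complex.Gamma s = (s - 1) * Complex.Gamma (s - 1) := by
      simpa using Complex.Gamma_add_one (s - 1) hne'
    have hΓ0 : Complex.Gamma (s - 1) ≠ 0 :=
      Complex.Gamma_ne_zero_of_re_pos (by linarith)
    have huv : (fun t : ℝ ↦ (t : ℂ) ^ (p + 1)) *
        (fun t : ℝ ↦ ((t : ℂ) + w) ^ (-(s - 1)) / (1 - s)) =
        fun t : ℝ ↦ (t : ℂ) ^ (p + 1) * (t + w) ^ (-(s - 1)) / (1 - s) := by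
      ext t
      simp [mul_div_assoc]
    have hu'v : (fun t : ℝ ↦ ((p : ℂ) + 1) * (t : ℂ) ^ p) *
        (fun t : ℝ ↦ ((t : ℂ) + w) ^ (-(s - 1)) / (1 - s)) =
        fun t : ℝ ↦ ((p : ℂ) + 1) / (1 - s) * ((t : ℂ) ^ p * (t + w) ^ (-(s - 1))) := by
      ext t
      simp only [Pi.mul_apply]
      ring
    have h_zero : Tendsto ((fun t : ℝ ↦ (t : ℂ) ^ (p + 1)) *
        (fun t : ℝ ↦ ((t : ℂ) + w) ^ (-(s - 1)) / (1 - s))) (𝓝[>] 0) (𝓝 0) := by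
      have hcont := ((continuousOn_pow_mul_add_cpow hw (-(s - 1)) (p + 1)).div_const (1 - s)
        0 self_mem_Ici).mono Ioi_subset_Ici_self
      rw [huv]
      simpa [ContinuousWithinAt] using hcont
    have h_infty : Tendsto ((fun t : ℝ ↦ (t : ℂ) ^ (p + 1)) *
        (fun t : ℝ ↦ ((t : ℂ) + w) ^ (-(s - 1)) / (1 - s))) atTop (𝓝 0) := by
      have hlim := (tendsto_pow_mul_add_cpow_atTop (s := s - 1) (p := p + 1) hw
        (by push_cast; exact hs')).div_const (1 - s)
      rw [huv]
      rwa [zero_div] at hlim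
    have h := integral_Ioi_mul_deriv_eq_deriv_mul (a := 0) (a' := 0) (b' := 0)
      (u := fun t : ℝ ↦ (t : ℂ) ^ (p + 1)) (u' := fun t : ℝ ↦ ((p : ℂ) + 1) * (t : ℂ) ^ p)
      (v := fun t : ℝ ↦ ((t : ℂ) + w) ^ (-(s - 1)) / (1 - s))
      (v' := fun t : ℝ ↦ ((t : ℂ) + w) ^ (-s))
      (fun t _ ↦ by simpa using (hasDerivAt_pow (p + 1) (t : ℂ)).comp_ofReal)
      (fun t ht ↦ hasDerivAt_add_cpow_div hw hne (mem_Ioi.1 ht).le)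
      (integrableOn_pow_mul_add_cpow hw (by push_cast; exact hs))
      (by rw [hu'v]; exact (integrableOn_pow_mul_add_cpow hw hs').const_mul _)
      h_zero h_infty
    rw [h]
    have hcongr := congrArg (fun f : ℝ → ℂ ↦ ∫ t in Ioi (0 : ℝ), f t) hu'v
    simp only [Pi.mul_apply] at hcongr
    rw [hcongr, integral_const_mul, ih (s - 1) hs', hΓ, Nat.factorial_succ]
    push_cast
    rw [show s - ((p : ℂ) + 1) - 1 = s - 1 - p - 1 by ring,
      show (p : ℂ) + 1 - (s - 1) = p + 1 + 1 - s by ring]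
    field_simp
    ring


/-- For `x₀ ∈ ℂ` with `Re x₀ < 0`, `p ∈ ℕ`, and `Re s > p + 1`,
`∫₀^∞ xᵖ (x − x₀)^{−s} dx = Γ(s − p − 1)·p!/Γ(s) · (−x₀)^{p+1−s}`,
powers taken via the principal branch of the complex logarithm. -/
theorem integral_pow_mul_sub_cpow
    (x₀ : ℂ) (hx : x₀.re < 0) (p : ℕ) (s : ℂ) (hs : (p : ℝ) + 1 < s.re) :
    (∫ t in Set.Ioi (0 : ℝ), (t : ℂ) ^ p * Complex.exp (-s * Complex.log ((t : ℂ) - x₀)))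
      = Complex.Gamma (s - p - 1) * (p.factorial : ℂ) / Complex.Gamma s
        * Complex.exp (((p : ℂ) + 1 - s) * Complex.log (-x₀)) := by
  have hw : 0 < (-x₀).re := by simpa using hx
  have hw0 : -x₀ ≠ 0 := fun h ↦ by simp [h] at hw
  rw [mul_comm ((p : ℂ) + 1 - s), ← Complex.cpow_def_of_ne_zero hw0,
    ← integral_pow_mul_add_cpow hw p s hs]
  refine setIntegral_congr_fun measurableSet_Ioi fun t ht ↦ ?_
  have hne := Complex.slitPlane_ne_zero (add_mem_slitPlane hw (mem_Ioi.1 ht).le)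
  simp only [Complex.cpow_def_of_ne_zero hne, sub_eq_add_neg, mul_comm (-s)]
end

section
/- (Lemma 1.) Define g(s) = ∫_0^∞ x^p · [ P^0(x)^{−s} − (1/n) Σ_{i=1}^n (x − x_i)^{−s} ] dx, which converges for Re s > p + 1. Then g extends holomorphically to 0; that is, there exist an open connected set U ⊆ ℂ containing 0 and the half-plane {s : Re s > p + 1} and a holomorphic function G : U → ℂ with G(s) = g(s) for Re s > p + 1; moreover every such extension satisfies G(0) = 0. -/
/-- The integrand of Lemma 1:
`xᵖ · [ P⁰(x)^{−s} − (1/n) Σᵢ (x − xᵢ)^{−s} ]`, where `P⁰(x) = ∏ᵢ (x − xᵢ)` and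
`P⁰(x)^{−s} = ∏ᵢ exp(−s·Log(x − xᵢ))`, `(x − xᵢ)^{−s} = exp(−s·Log(x − xᵢ))`. -/
noncomputable def lemmaOneIntegrand (n : ℕ) (x : Fin n → ℂ) (p : ℕ) (s : ℂ) (t : ℝ) : ℂ :=
  (t : ℂ) ^ p *
    ((∏ i : Fin n, Complex.exp (-s * Complex.log ((t : ℂ) - x i)))
      - (n : ℂ)⁻¹ * ∑ i : Fin n, Complex.exp (-s * Complex.log ((t : ℂ) - x i)))

/-- `g(s) = ∫₀^∞ xᵖ · [ P⁰(x)^{−s} − (1/n) Σᵢ (x − xᵢ)^{−s} ] dx`. -/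
noncomputable def lemmaOneG (n : ℕ) (x : Fin n → ℂ) (p : ℕ) (s : ℂ) : ℂ :=
  ∫ t in Set.Ioi (0 : ℝ), lemmaOneIntegrand n x p s t

open MeasureTheory Set Filter Topology

lemma exists_norm_log_sub_log_one_add_le {z : ℂ} (hz : z.re < 0) :
    ∃ B : ℝ, 0 ≤ B ∧ ∀ t : ℝ, 0 ≤ t →
      ‖Complex.log ((t : ℂ) - z) - (Real.log (1 + t) : ℝ)‖ ≤ B := by
  set c := min 1 (-z.re) with hc
  have hc0 : 0 < c := lt_min one_pos (by linarith)
  refine ⟨|Real.log c| + |Real.log (1 + ‖z‖)| + Real.pi, by positivity, fun t ht => ?_⟩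
  have h1t : 0 < 1 + t := by linarith
  have hlow : c * (1 + t) ≤ ‖(t : ℂ) - z‖ := by
    have h1 : t - z.re ≤ ‖(t : ℂ) - z‖ := by
      simpa using Complex.re_le_norm ((t : ℂ) - z)
    have h2 : c ≤ -z.re := min_le_right _ _
    have h3 : c * t ≤ 1 * t := mul_le_mul_of_nonneg_right (min_le_left _ _) ht
    linarith
  have hup : ‖(t : ℂ) - z‖ ≤ (1 + ‖z‖) * (1 + t) := by
    have h1 : ‖(t : ℂ) - z‖ ≤ t + ‖z‖ := by
      simpa [abs_of_nonneg ht] using norm_sub_le (t : ℂ) z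
    nlinarith [norm_nonneg z, mul_nonneg (norm_nonneg z) ht]
  have hpos : 0 < ‖(t : ℂ) - z‖ := lt_of_lt_of_le (by positivity) hlow
  have hl1 := Real.log_le_log (by positivity) hlow
  have hl2 := Real.log_le_log hpos hup
  rw [Real.log_mul hc0.ne' h1t.ne'] at hl1
  rw [Real.log_mul (by positivity) h1t.ne'] at hl2
  refine (Complex.norm_le_abs_re_add_abs_im _).trans (add_le_add ?_ ?_)
  · simp only [Complex.sub_re, Complex.log_re, Complex.ofReal_re]
    rw [abs_le]
    constructor <;>
    linarith [neg_abs_le (Real.log c), le_abs_self (Real.log (1 + ‖z‖)),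
      abs_nonneg (Real.log c), abs_nonneg (Real.log (1 + ‖z‖))]
  · simpa [Complex.log_im] using Complex.abs_arg_le_pi ((t : ℂ) - z)

section ShiftedPowers

variable {ι : Type*} [Fintype ι]

/-- The function `tᵖ ∏ᵢ (t - xᵢ)^{-wᵢ}`. -/
noncomputable def shiftedPowers (x : ι → ℂ) (p : ℕ) (w : ι → ℂ) (t : ℝ) : ℂ :=
  (t : ℂ) ^ p * Complex.exp (-∑ i, w i * Complex.log ((t : ℂ) - x i))

/-- The integral `∫₀^∞ tᵖ ∏ᵢ (t - xᵢ)^{-wᵢ} dt`. -/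
noncomputable def shiftedPowersIntegral (x : ι → ℂ) (p : ℕ) (w : ι → ℂ) : ℂ :=
  ∫ t in Ioi (0 : ℝ), shiftedPowers x p w t

variable {x : ι → ℂ}

lemma sub_mem_slitPlane_of_re_neg {z : ℂ} (hz : z.re < 0) {t : ℝ} (ht : 0 ≤ t) :
    (t : ℂ) - z ∈ Complex.slitPlane := by
  left
  simp
  linarith

lemma continuousOn_log_sub {z : ℂ} (hz : z.re < 0) :
    ContinuousOn (fun t : ℝ => Complex.log ((t : ℂ) - z)) (Ici 0) := by
  refine ContinuousOn.clog (by fun_prop) fun t ht => sub_mem_slitPlane_of_re_neg hz ht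

lemma continuousOn_shiftedPowers (hx : ∀ i, (x i).re < 0) (p : ℕ) (w : ι → ℂ) :
    ContinuousOn (shiftedPowers x p w) (Ici 0) := by
  unfold shiftedPowers
  refine ContinuousOn.mul (by fun_prop) (ContinuousOn.cexp (ContinuousOn.neg ?_))
  exact continuousOn_finsetSum _ fun i _ => continuousOn_const.mul (continuousOn_log_sub (hx i))

lemma norm_shiftedPowers_le {B : ι → ℝ}
    (hB : ∀ i, ∀ t : ℝ, 0 ≤ t →
      ‖Complex.log ((t : ℂ) - x i) - (Real.log (1 + t) : ℝ)‖ ≤ B i)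
    (p : ℕ) (w : ι → ℂ) {t : ℝ} (ht : 0 ≤ t) :
    ‖shiftedPowers x p w t‖ ≤
      Real.exp (∑ i, ‖w i‖ * B i) * (1 + t) ^ ((p : ℝ) - (∑ i, w i).re) := by
  have h1t : 0 < 1 + t := by linarith
  have hexp : (-∑ i, w i * Complex.log ((t : ℂ) - x i)).re ≤
      (∑ i, ‖w i‖ * B i) - (∑ i, w i).re * Real.log (1 + t) := by
    have : -∑ i, w i * Complex.log ((t : ℂ) - x i) =
        -(∑ i, w i * (Complex.log ((t : ℂ) - x i) - (Real.log (1 + t) : ℝ)))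
          - (∑ i, w i) * (Real.log (1 + t) : ℝ) := by
      simp only [mul_sub, Finset.sum_sub_distrib, Finset.sum_mul]
      ring
    rw [this, Complex.sub_re, Complex.re_mul_ofReal]
    gcongr
    refine (Complex.re_le_norm _).trans ?_
    rw [norm_neg]
    refine (norm_sum_le _ _).trans (Finset.sum_le_sum fun i _ => ?_)
    rw [norm_mul]
    exact mul_le_mul_of_nonneg_left (hB i t ht) (norm_nonneg _)
  have htp : t ^ p ≤ (1 + t) ^ (p : ℝ) := by
    rw [Real.rpow_natCast]
    gcongr
    linarith
  rw [shiftedPowers, norm_mul, Complex.norm_exp, norm_pow, Complex.norm_real,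
    Real.norm_of_nonneg ht]
  calc t ^ p * Real.exp (-∑ i, w i * Complex.log ((t : ℂ) - x i)).re
      ≤ (1 + t) ^ (p : ℝ) *
        Real.exp ((∑ i, ‖w i‖ * B i) - (∑ i, w i).re * Real.log (1 + t)) := by
        gcongr
    _ = _ := by
      rw [Real.rpow_sub h1t, Real.exp_sub, mul_comm (∑ i, w i).re, ← Real.rpow_def_of_pos h1t]
      ring

lemma integrableOn_one_add_rpow {a : ℝ} (ha : a < -1) :
    IntegrableOn (fun t : ℝ => (1 + t) ^ a) (Ioi 0) := by
  simpa [add_comm] using integrableOn_add_rpow_Ioi_of_lt (c := 0) (m := 1) ha (by norm_num)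

omit [Fintype ι] in
lemma exists_log_bounds (hx : ∀ i, (x i).re < 0) :
    ∃ B : ι → ℝ, (∀ i, 0 ≤ B i) ∧ ∀ i, ∀ t : ℝ, 0 ≤ t →
      ‖Complex.log ((t : ℂ) - x i) - (Real.log (1 + t) : ℝ)‖ ≤ B i := by
  choose B hB0 hB using fun i => exists_norm_log_sub_log_one_add_le (hx i)
  exact ⟨B, hB0, hB⟩

lemma integrableOn_shiftedPowers (hx : ∀ i, (x i).re < 0) (p : ℕ) {w : ι → ℂ}
    (hw : (p : ℝ) + 1 < (∑ i, w i).re) :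
    IntegrableOn (shiftedPowers x p w) (Ioi 0) := by
  obtain ⟨B, -, hB⟩ := exists_log_bounds hx
  refine Integrable.mono' ((integrableOn_one_add_rpow
    (a := (p : ℝ) - (∑ i, w i).re) (by linarith)).const_mul (Real.exp (∑ i, ‖w i‖ * B i)))
    (((continuousOn_shiftedPowers hx p w).mono Ioi_subset_Ici_self).aestronglyMeasurable
      measurableSet_Ioi) ?_
  filter_upwards [ae_restrict_mem measurableSet_Ioi] with t ht
  exact norm_shiftedPowers_le hB p w (le_of_lt ht)

lemma hasDerivAt_shiftedPowers [DecidableEq ι] (hx : ∀ i, (x i).re < 0) (p : ℕ) (w : ι → ℂ)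
    {t : ℝ} (ht : 0 ≤ t) :
    HasDerivAt (shiftedPowers x (p + 1) w)
      (((p : ℂ) + 1 - ∑ i, w i) * shiftedPowers x p w t
        - ∑ i, w i * x i * shiftedPowers x p (w + Pi.single i 1) t) t := by
  have hlog : ∀ i, HasDerivAt (fun t : ℝ => Complex.log ((t : ℂ) - x i))
      (1 / ((t : ℂ) - x i)) t := fun i =>
    (Complex.ofRealCLM.hasDerivAt.sub_const (x i)).clog_real
      (sub_mem_slitPlane_of_re_neg (hx i) ht)
  have hsum : HasDerivAt (fun t : ℝ => -∑ i, w i * Complex.log ((t : ℂ) - x i))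
      (-∑ i, w i * (1 / ((t : ℂ) - x i))) t :=
    (HasDerivAt.fun_sum fun i _ => (hlog i).const_mul (w i)).neg
  have hpow : HasDerivAt (fun t : ℝ => (t : ℂ) ^ (p + 1)) (((p : ℂ) + 1) * (t : ℂ) ^ p) t := by
    simpa using (Complex.ofRealCLM.hasDerivAt (x := t)).fun_pow (p + 1)
  have hne : ∀ i, (t : ℂ) - x i ≠ 0 := fun i =>
    Complex.slitPlane_ne_zero (sub_mem_slitPlane_of_re_neg (hx i) ht)
  have hshift : ∀ i, shiftedPowers x p (w + Pi.single i 1) t =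
      shiftedPowers x p w t / ((t : ℂ) - x i) := by
    intro i
    have : ∑ j, (w + Pi.single i 1 : ι → ℂ) j * Complex.log ((t : ℂ) - x j) =
        ∑ j, w j * Complex.log ((t : ℂ) - x j) + Complex.log ((t : ℂ) - x i) := by
      simp [add_mul, Finset.sum_add_distrib, Pi.single_apply]
    rw [shiftedPowers, this, neg_add, Complex.exp_add, Complex.exp_neg (Complex.log _),
      Complex.exp_log (hne i), shiftedPowers]
    ring
  refine (hpow.mul hsum.cexp).congr_deriv ?_
  simp only [hshift]
  have hterm : ∀ i, w i * x i * (shiftedPowers x p w t / ((t : ℂ) - x i)) =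
      (w i * (1 / ((t : ℂ) - x i))) * (t * shiftedPowers x p w t)
        - w i * shiftedPowers x p w t := by
    intro i
    have := hne i
    field_simp
    ring
  simp only [hterm, Finset.sum_sub_distrib, ← Finset.sum_mul]
  simp only [shiftedPowers]
  ring

lemma shiftedPowersIntegral_recurrence [DecidableEq ι] (hx : ∀ i, (x i).re < 0) (p : ℕ)
    {w : ι → ℂ} (hw : (p : ℝ) + 1 < (∑ i, w i).re) :
    ((∑ i, w i) - p - 1) * shiftedPowersIntegral x p w =
      -∑ i, w i * x i * shiftedPowersIntegral x p (w + Pi.single i 1) := by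
  have hint : ∀ i, IntegrableOn (shiftedPowers x p (w + Pi.single i 1)) (Ioi 0) := fun i =>
    integrableOn_shiftedPowers hx p (by
      simp only [Pi.add_apply, Finset.sum_add_distrib, Finset.sum_pi_single', Finset.mem_univ,
        if_true, Complex.add_re, Complex.one_re]
      linarith)
  have hint0 := integrableOn_shiftedPowers hx p hw
  have hsum : IntegrableOn
      (fun t => ∑ i, w i * x i * shiftedPowers x p (w + Pi.single i 1) t) (Ioi 0) :=
    integrable_finsetSum _ fun i _ => (hint i).const_mul _
  have hlim : Tendsto (shiftedPowers x (p + 1) w) atTop (𝓝 0) := by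
    obtain ⟨B, -, hB⟩ := exists_log_bounds hx
    have h1 : Tendsto (fun t : ℝ => (1 + t) ^ (((p + 1 : ℕ) : ℝ) - (∑ i, w i).re))
        atTop (𝓝 0) := by
      have := (tendsto_rpow_neg_atTop (y := (∑ i, w i).re - ((p + 1 : ℕ) : ℝ))
        (by push_cast; linarith)).comp (tendsto_atTop_add_const_left atTop 1 tendsto_id)
      simpa [Function.comp_def] using this
    refine squeeze_zero_norm' ?_ (by simpa only [mul_zero] using h1.const_mul (Real.exp (∑ i, ‖w i‖ * B i)))
    filter_upwards [eventually_ge_atTop 0] with t ht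
    exact norm_shiftedPowers_le hB (p + 1) w ht
  have hftc := integral_Ioi_of_hasDerivAt_of_tendsto' (a := (0 : ℝ))
    (fun t ht => hasDerivAt_shiftedPowers hx p w ht)
    ((hint0.const_mul ((p : ℂ) + 1 - ∑ i, w i)).sub hsum) hlim
  have hzero : shiftedPowers x (p + 1) w 0 = 0 := by simp [shiftedPowers]
  rw [integral_sub (hint0.const_mul _) hsum, integral_const_mul,
    integral_finsetSum _ fun i _ => (hint i).const_mul _, hzero, sub_zero] at hftc
  simp only [integral_const_mul] at hftc
  simp only [shiftedPowersIntegral]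
  linear_combination -hftc

lemma differentiableAt_shiftedPowersIntegral (hx : ∀ i, (x i).re < 0) (p : ℕ)
    (c : ι → ℂ) {s₀ : ℂ} (hs : (p : ℝ) + 1 < (∑ i, (c i + s₀)).re) :
    DifferentiableAt ℂ (fun s => shiftedPowersIntegral x p (fun i => c i + s)) s₀ := by
  obtain ⟨B, hB0, hB⟩ := exists_log_bounds hx
  set n : ℝ := (Fintype.card ι : ℝ) with hn
  have hn0 : 0 ≤ n := by positivity
  set R := (∑ i, (c i + s₀)).re with hR
  set ε := (R - p - 1) / (n + 2) with hε
  have hε0 : 0 < ε := div_pos (by linarith) (by linarith)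
  have hεR : ε * (n + 2) = R - p - 1 := div_mul_cancel₀ _ (by linarith)
  set C := Real.exp (∑ i, (‖c i‖ + ‖s₀‖ + ε) * B i) with hC
  set D := ∑ i, (B i + 1 / ε) with hD
  have hD0 : 0 ≤ D := Finset.sum_nonneg fun i _ => add_nonneg (hB0 i) (by positivity)
  have hcont : ContinuousOn (fun t : ℝ => -∑ i, Complex.log ((t : ℂ) - x i)) (Ici 0) :=
    (continuousOn_finsetSum _ fun i _ => continuousOn_log_sub (hx i)).neg
  refine (hasDerivAt_integral_of_dominated_loc_of_deriv_le
    (μ := volume.restrict (Ioi (0 : ℝ)))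
    (F := fun s t => shiftedPowers x p (fun i => c i + s) t)
    (F' := fun s t => shiftedPowers x p (fun i => c i + s) t *
      (-∑ i, Complex.log ((t : ℂ) - x i)))
    (bound := fun t => C * D * (1 + t) ^ ((p : ℝ) - R + n * ε + ε))
    (Metric.ball_mem_nhds s₀ hε0) (Eventually.of_forall fun s => ?_)
    (integrableOn_shiftedPowers hx p hs) ?_ ?_ ?_ ?_).2.differentiableAt
  · exact ((continuousOn_shiftedPowers hx p _).mono
      Ioi_subset_Ici_self).aestronglyMeasurable measurableSet_Ioi
  · exact (((continuousOn_shiftedPowers hx p _).mul hcont).mono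
      Ioi_subset_Ici_self).aestronglyMeasurable measurableSet_Ioi
  · filter_upwards [ae_restrict_mem measurableSet_Ioi] with t ht s hs'
    have ht0 : (0 : ℝ) ≤ t := le_of_lt ht
    have h1t : 0 < 1 + t := by linarith
    have h1t' : 1 ≤ 1 + t := by linarith
    rw [mem_ball_iff_norm] at hs'
    have hre : R - n * ε ≤ (∑ i, (c i + s)).re := by
      have h1 : (∑ i, (c i + s)).re = R + n * (s - s₀).re := by
        simp [hR, Finset.sum_add_distrib, hn]
        ring
      have h2 : -ε ≤ (s - s₀).re :=
        (neg_le_neg hs'.le).trans (abs_le.1 (Complex.abs_re_le_norm (s - s₀))).1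
      rw [h1]
      nlinarith
    have hker : ‖shiftedPowers x p (fun i => c i + s) t‖ ≤
        C * (1 + t) ^ ((p : ℝ) - R + n * ε) := by
      refine (norm_shiftedPowers_le hB p _ ht0).trans ?_
      gcongr
      · rw [hC]
        gcongr with i
        · exact hB0 i
        · have h3 : ‖s‖ ≤ ‖s₀‖ + ‖s - s₀‖ := by simpa using norm_add_le s₀ (s - s₀)
          linarith [norm_add_le (c i) s]
      · linarith
    have hlog : ‖-∑ i, Complex.log ((t : ℂ) - x i)‖ ≤ D * (1 + t) ^ ε := by
      rw [norm_neg, hD, Finset.sum_mul]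
      refine (norm_sum_le _ _).trans (Finset.sum_le_sum fun i _ => ?_)
      have h1 : ‖Complex.log ((t : ℂ) - x i)‖ ≤ B i + Real.log (1 + t) := by
        have h2 := norm_add_le (Complex.log ((t : ℂ) - x i) - (Real.log (1 + t) : ℝ))
          ((Real.log (1 + t) : ℝ) : ℂ)
        rw [sub_add_cancel, Complex.norm_real, Real.norm_of_nonneg (Real.log_nonneg h1t')] at h2
        linarith [hB i t ht0]
      have h2 := Real.log_le_rpow_div h1t.le hε0
      have h3 : 1 ≤ (1 + t) ^ ε := Real.one_le_rpow h1t' hε0.le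
      have h4 := le_mul_of_one_le_right (hB0 i) h3
      rw [add_mul, one_div_mul_eq_div]
      linarith
    rw [norm_mul, Real.rpow_add h1t]
    calc _ ≤ (C * (1 + t) ^ ((p : ℝ) - R + n * ε)) * (D * (1 + t) ^ ε) := by gcongr
      _ = _ := by ring
  · exact (integrableOn_one_add_rpow (by linarith)).const_mul _
  · filter_upwards with t s _
    have h1 : HasDerivAt (fun s : ℂ => -∑ i, (c i + s) * Complex.log ((t : ℂ) - x i))
        (-∑ i, Complex.log ((t : ℂ) - x i)) s := by
      refine (HasDerivAt.fun_sum fun i _ => ?_).neg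
      simpa using ((hasDerivAt_id s).const_add (c i)).mul_const (Complex.log ((t : ℂ) - x i))
    refine (h1.cexp.const_mul ((t : ℂ) ^ p)).congr_deriv ?_
    simp only [shiftedPowers]
    ring

/-- The iterates of the recurrence for `shiftedPowersIntegral`, with the denominators cleared. -/
noncomputable def clearedContinuation [DecidableEq ι] (x : ι → ℂ) (p : ℕ) : ℕ → (ι → ℂ) → ℂ
  | 0, w => shiftedPowersIntegral x p w
  | N + 1, w => -∑ i, w i * x i * clearedContinuation x p N (w + Pi.single i 1)

variable [DecidableEq ι]

lemma sum_add_single (w : ι → ℂ) (i : ι) :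
    ∑ j, (w + Pi.single i 1 : ι → ℂ) j = ∑ j, w j + 1 := by
  simp [Finset.sum_add_distrib]

lemma clearedContinuation_eq (hx : ∀ i, (x i).re < 0) (p N : ℕ) {w : ι → ℂ}
    (hw : (p : ℝ) + 1 < (∑ i, w i).re) :
    clearedContinuation x p N w =
      (∏ k ∈ Finset.range N, ((∑ i, w i) + k - p - 1)) * shiftedPowersIntegral x p w := by
  induction N generalizing w with
  | zero => simp [clearedContinuation]
  | succ N ih =>
    have h : ∀ i, clearedContinuation x p N (w + Pi.single i 1) =
        (∏ k ∈ Finset.range N, ((∑ i, w i) + (k + 1 : ℕ) - p - 1)) *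
          shiftedPowersIntegral x p (w + Pi.single i 1) := by
      intro i
      rw [ih (by rw [sum_add_single, Complex.add_re, Complex.one_re]; linarith), sum_add_single]
      congr 1
      refine Finset.prod_congr rfl fun k _ => ?_
      push_cast
      ring
    have hrec := shiftedPowersIntegral_recurrence hx p hw
    rw [clearedContinuation, Finset.prod_range_succ', mul_assoc, Nat.cast_zero, add_zero, hrec,
      mul_neg, Finset.mul_sum]
    congr 1
    refine Finset.sum_congr rfl fun i _ => ?_
    rw [h]
    ring

lemma differentiableAt_clearedContinuation (hx : ∀ i, (x i).re < 0) (p N : ℕ)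
    (c : ι → ℂ) {s₀ : ℂ} (hs : (p : ℝ) + 1 < (∑ i, (c i + s₀)).re + N) :
    DifferentiableAt ℂ (fun s => clearedContinuation x p N (fun i => c i + s)) s₀ := by
  induction N generalizing c with
  | zero => exact differentiableAt_shiftedPowersIntegral hx p c (by simpa using hs)
  | succ N ih =>
    simp only [clearedContinuation]
    refine (DifferentiableAt.fun_sum fun i _ => DifferentiableAt.mul (by fun_prop) ?_).neg
    have h := ih (c + Pi.single i 1) (by
      simp only [Pi.add_apply, add_right_comm _ _ s₀]
      have := sum_add_single (fun j => c j + s₀) i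
      simp only [Pi.add_apply] at this
      rw [this, Complex.add_re, Complex.one_re]
      push_cast at hs
      linarith)
    refine h.congr_of_eventuallyEq (Eventually.of_forall fun s => ?_)
    refine congrArg _ (funext fun j => ?_)
    simp only [Pi.add_apply]
    ring

lemma clearedContinuation_single (p N : ℕ) (i : ι) (a : ℂ) :
    clearedContinuation x p N (Pi.single i a) =
      clearedContinuation (fun _ : Unit => x i) p N (fun _ => a) := by
  induction N generalizing a with
  | zero =>
    simp only [clearedContinuation, shiftedPowersIntegral, shiftedPowers]
    congr 1
    funext t
    simp [Pi.single_apply]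
  | succ N ih =>
    simp only [clearedContinuation]
    rw [Finset.sum_eq_single i]
    · rw [← Pi.single_add, ih]
      simp only [Pi.single_eq_same, Finset.univ_unique, Finset.sum_singleton]
      congr 3
    · intro j _ hj
      simp [Pi.single_eq_of_ne hj]
    · simp

/-- The denominator of the continued integral, without the factor vanishing at `0`. -/
noncomputable def reducedDenominator (m p M : ℕ) (s : ℂ) : ℂ :=
  ∏ k ∈ (Finset.range (M + 1)).erase (p + 1), ((m : ℂ) * s + k - p - 1)

omit [Fintype ι] [DecidableEq ι] in
lemma differentiable_reducedDenominator (m p M : ℕ) :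
    Differentiable ℂ (reducedDenominator m p M) := by
  unfold reducedDenominator
  fun_prop

lemma reducedDenominator_ne_zero_of_im_pos {m : ℕ} (hm : 1 ≤ m) (p M : ℕ) {s : ℂ}
    (hs : 0 < s.im) : reducedDenominator m p M s ≠ 0 := by
  refine Finset.prod_ne_zero_iff.2 fun k _ h => ?_
  have h1 := congrArg Complex.im h
  have hm' : (0 : ℝ) < m := by exact_mod_cast hm
  simp at h1
  rcases h1 with h1 | h1
  · omega
  · exact hs.ne' h1

lemma reducedDenominator_ne_zero_of_lt_re {m : ℕ} (hm : 1 ≤ m) (p M : ℕ) {s : ℂ}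
    (hs : (p : ℝ) + 1 < s.re) : reducedDenominator m p M s ≠ 0 := by
  refine Finset.prod_ne_zero_iff.2 fun k _ h => ?_
  have h1 := congrArg Complex.re h
  have hm' : (1 : ℝ) ≤ m := by exact_mod_cast hm
  have hk : (0 : ℝ) ≤ k := by positivity
  have hp : (0 : ℝ) ≤ p := by positivity
  simp at h1
  nlinarith

lemma reducedDenominator_zero_ne_zero (m p M : ℕ) : reducedDenominator m p M 0 ≠ 0 := by
  refine Finset.prod_ne_zero_iff.2 fun k hk h => (Finset.mem_erase.1 hk).1 ?_
  have : (k : ℂ) = ((p + 1 : ℕ) : ℂ) := by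
    push_cast
    linear_combination h
  exact_mod_cast this

lemma reducedDenominator_zero_congr (m m' p M : ℕ) :
    reducedDenominator m p M 0 = reducedDenominator m' p M 0 := by
  simp [reducedDenominator]

lemma reducedDenominator_mul_integral (hx : ∀ i, (x i).re < 0) {p M : ℕ} (hM : p < M)
    [Nonempty ι] {s : ℂ} (hs : (p : ℝ) + 1 < s.re) :
    (Fintype.card ι : ℂ) * reducedDenominator (Fintype.card ι) p M s *
        shiftedPowersIntegral x p (fun _ => s) =
      -∑ i, x i * clearedContinuation x p M (fun j => (Pi.single i 1 : ι → ℂ) j + s) := by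
  have hcard : (1 : ℝ) ≤ Fintype.card ι := by exact_mod_cast Fintype.card_pos
  have hp : (0 : ℝ) ≤ p := by positivity
  have hs0 : s ≠ 0 := by
    rintro rfl
    simp at hs
    linarith
  have hw : (p : ℝ) + 1 < (∑ _i : ι, s).re := by
    simp
    nlinarith
  have h := clearedContinuation_eq hx p (M + 1) hw
  rw [← Finset.mul_prod_erase (Finset.range (M + 1)) _
    (Finset.mem_range.2 (by omega : p + 1 < M + 1)), clearedContinuation] at h
  simp only [Finset.sum_const, Finset.card_univ, nsmul_eq_mul] at h
  have hadd : ∀ i : ι, (fun _ => s) + (Pi.single i 1 : ι → ℂ) =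
      fun j => (Pi.single i 1 : ι → ℂ) j + s := fun i => funext fun j => add_comm _ _
  simp only [hadd, mul_assoc s, ← Finset.mul_sum] at h
  refine mul_left_cancel₀ hs0 ?_
  rw [reducedDenominator]
  push_cast at h
  linear_combination -h

end ShiftedPowers

lemma lemmaOneIntegrand_eq (n : ℕ) (x : Fin n → ℂ) (p : ℕ) (s : ℂ) :
    lemmaOneIntegrand n x p s = fun t => shiftedPowers x p (fun _ => s) t
      - (n : ℂ)⁻¹ * ∑ i, shiftedPowers (fun _ : Unit => x i) p (fun _ => s) t := by
  funext t
  simp only [lemmaOneIntegrand, shiftedPowers, ← Finset.mul_sum, ← Complex.exp_sum,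
    Finset.univ_unique, Finset.sum_singleton, neg_mul, Finset.sum_neg_distrib]
  ring

section

variable {n : ℕ} {x : Fin n → ℂ} {p : ℕ} {s : ℂ}

lemma integrableOn_joint (hn : 1 ≤ n) (hre : ∀ i, (x i).re < 0)
    (hs : (p : ℝ) + 1 < s.re) :
    IntegrableOn (shiftedPowers x p (fun _ => s)) (Ioi 0) := by
  refine integrableOn_shiftedPowers hre p ?_
  have hn' : (1 : ℝ) ≤ n := by exact_mod_cast hn
  have hp : (0 : ℝ) ≤ p := by positivity
  simp
  nlinarith

lemma integrableOn_single (hre : ∀ i, (x i).re < 0) (hs : (p : ℝ) + 1 < s.re) (i : Fin n) :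
    IntegrableOn (shiftedPowers (fun _ : Unit => x i) p (fun _ => s)) (Ioi 0) :=
  integrableOn_shiftedPowers (fun _ => hre i) p (by simpa using hs)

lemma integrableOn_lemmaOneIntegrand (hn : 1 ≤ n) (hre : ∀ i, (x i).re < 0)
    (hs : (p : ℝ) + 1 < s.re) : IntegrableOn (lemmaOneIntegrand n x p s) (Ioi 0) := by
  rw [lemmaOneIntegrand_eq]
  exact (integrableOn_joint hn hre hs).sub
    ((integrable_finsetSum _ fun i _ => integrableOn_single hre hs i).const_mul _)

lemma lemmaOneG_eq (hn : 1 ≤ n) (hre : ∀ i, (x i).re < 0) (hs : (p : ℝ) + 1 < s.re) :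
    lemmaOneG n x p s = shiftedPowersIntegral x p (fun _ => s)
      - (n : ℂ)⁻¹ * ∑ i, shiftedPowersIntegral (fun _ : Unit => x i) p (fun _ => s) := by
  rw [lemmaOneG, lemmaOneIntegrand_eq, integral_sub (integrableOn_joint hn hre hs)
    ((integrable_finsetSum _ fun i _ => integrableOn_single hre hs i).const_mul _),
    integral_const_mul, integral_finsetSum _ fun i _ => integrableOn_single hre hs i]
  rfl

/-- Up to any vertical line, `lemmaOneG` is a quotient of holomorphic functions whose numerator
vanishes at `0` while its denominator does not. -/
lemma exists_mul_lemmaOneG_eq (hn : 1 ≤ n) (hre : ∀ i, (x i).re < 0) (p K : ℕ) :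
    ∃ Q H : ℂ → ℂ, Differentiable ℂ Q ∧ DifferentiableOn ℂ H {s | -(K : ℝ) < s.re} ∧
      Q 0 ≠ 0 ∧ H 0 = 0 ∧ (∀ s : ℂ, 0 < s.im → Q s ≠ 0) ∧
      ∀ s : ℂ, (p : ℝ) + 1 < s.re → Q s ≠ 0 ∧ Q s * lemmaOneG n x p s = H s := by
  have hn0 : (n : ℂ) ≠ 0 := by exact_mod_cast (by omega : n ≠ 0)
  have hn' : (1 : ℝ) ≤ n := by exact_mod_cast hn
  have hK : (0 : ℝ) ≤ K := by positivity
  have : Nonempty (Fin n) := ⟨⟨0, hn⟩⟩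
  set M := p + 1 + n * K with hM
  have hpM : p < M := by omega
  refine ⟨fun s => n * reducedDenominator n p M s * reducedDenominator 1 p M s,
    fun s => reducedDenominator n p M s *
        ∑ i, x i * clearedContinuation (fun _ : Unit => x i) p M (fun _ => 1 + s)
      - reducedDenominator 1 p M s *
        ∑ i, x i * clearedContinuation x p M (fun j => (Pi.single i 1 : Fin n → ℂ) j + s),
    ?_, ?_, ?_, ?_, ?_, ?_⟩
  · exact ((differentiable_reducedDenominator n p M).const_mul _).mul
      (differentiable_reducedDenominator 1 p M)
  · intro s hs
    rw [mem_ofPred_eq] at hs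
    refine DifferentiableAt.differentiableWithinAt (DifferentiableAt.sub
      ((differentiable_reducedDenominator n p M s).mul
        (DifferentiableAt.fun_sum fun i _ => DifferentiableAt.const_mul ?_ _))
      ((differentiable_reducedDenominator 1 p M s).mul
        (DifferentiableAt.fun_sum fun i _ => DifferentiableAt.const_mul ?_ _)))
    · refine differentiableAt_clearedContinuation (fun _ => hre i) p M (fun _ => 1) ?_
      simp [hM]
      nlinarith
    · refine differentiableAt_clearedContinuation hre p M _ ?_
      simp [hM, Finset.sum_add_distrib]
      nlinarith
  · exact mul_ne_zero (mul_ne_zero hn0 (reducedDenominator_zero_ne_zero _ _ _))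
      (reducedDenominator_zero_ne_zero _ _ _)
  · simp only [add_zero, clearedContinuation_single]
    rw [reducedDenominator_zero_congr n 1, sub_self]
  · exact fun s hs => mul_ne_zero
      (mul_ne_zero hn0 (reducedDenominator_ne_zero_of_im_pos hn _ _ hs))
      (reducedDenominator_ne_zero_of_im_pos le_rfl _ _ hs)
  · refine fun s hs => ⟨mul_ne_zero
      (mul_ne_zero hn0 (reducedDenominator_ne_zero_of_lt_re hn _ _ hs))
      (reducedDenominator_ne_zero_of_lt_re le_rfl _ _ hs), ?_⟩
    have h1 := reducedDenominator_mul_integral hre hpM hs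
    have h2 : ∀ i, reducedDenominator 1 p M s *
        shiftedPowersIntegral (fun _ : Unit => x i) p (fun _ => s) =
        -(x i * clearedContinuation (fun _ : Unit => x i) p M (fun _ => 1 + s)) := by
      intro i
      have h := reducedDenominator_mul_integral (x := fun _ : Unit => x i)
        (fun _ => hre i) hpM hs
      simpa using h
    have h3 : reducedDenominator 1 p M s *
        ∑ i, shiftedPowersIntegral (fun _ : Unit => x i) p (fun _ => s) =
        -∑ i, x i * clearedContinuation (fun _ : Unit => x i) p M (fun _ => 1 + s) := by
      rw [Finset.mul_sum, Finset.sum_congr rfl fun i _ => h2 i, Finset.sum_neg_distrib]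
    rw [Fintype.card_fin] at h1
    rw [lemmaOneG_eq hn hre hs]
    have hinv : (n : ℂ) * (n : ℂ)⁻¹ = 1 := mul_inv_cancel₀ hn0
    linear_combination reducedDenominator 1 p M s * h1 - reducedDenominator n p M s * h3
      - reducedDenominator n p M s * reducedDenominator 1 p M s *
        (∑ i, shiftedPowersIntegral (fun _ : Unit => x i) p (fun _ => s)) * hinv

end

/-- A quotient of holomorphic functions whose denominator vanishes neither at `0`, nor in the upper
half-plane, nor in the right half-plane, is holomorphic on a connected open set joining these. -/
lemma exists_connected_extension (p : ℕ) {g Q H : ℂ → ℂ} (hQ : Differentiable ℂ Q)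
    (hH : DifferentiableOn ℂ H {s | -1 < s.re}) (hQ0 : Q 0 ≠ 0)
    (hQim : ∀ s : ℂ, 0 < s.im → Q s ≠ 0)
    (hQH : ∀ s : ℂ, (p : ℝ) + 1 < s.re → Q s ≠ 0 ∧ Q s * g s = H s) :
    ∃ U : Set ℂ, ∃ G : ℂ → ℂ, IsOpen U ∧ IsConnected U ∧ (0 : ℂ) ∈ U ∧
      {s : ℂ | (p : ℝ) + 1 < s.re} ⊆ U ∧ DifferentiableOn ℂ G U ∧
      ∀ s : ℂ, (p : ℝ) + 1 < s.re → G s = g s := by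
  have hp : (0 : ℝ) ≤ p := by positivity
  have hopen : IsOpen {s : ℂ | -1 < s.re} := isOpen_lt continuous_const Complex.continuous_re
  obtain ⟨r, hr, hball⟩ := Metric.mem_nhds_iff.1 (Filter.inter_mem
    (hQ.continuous.continuousAt.eventually_ne hQ0)
    (hopen.mem_nhds (by simp : (0 : ℂ) ∈ {s : ℂ | -1 < s.re})))
  set A := {s : ℂ | -1 < s.re} ∩ {s : ℂ | 0 < s.im} with hA
  set R := {s : ℂ | (p : ℝ) + 1 < s.re} with hR
  have hAo : IsOpen A := hopen.inter (isOpen_lt continuous_const Complex.continuous_im)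
  have hRo : IsOpen R := isOpen_lt continuous_const Complex.continuous_re
  have hAc : Convex ℝ A := (convex_halfSpace_re_gt _).inter (convex_halfSpace_im_gt _)
  have hRc : Convex ℝ R := convex_halfSpace_re_gt _
  have hU : ∀ s ∈ Metric.ball 0 r ∪ A ∪ R, Q s ≠ 0 ∧ -1 < s.re := by
    rintro s ((hs | hs) | hs)
    · exact hball hs
    · exact ⟨hQim s hs.2, hs.1⟩
    · have hs' : (p : ℝ) + 1 < s.re := hs
      exact ⟨(hQH s hs).1, by linarith⟩
  refine ⟨Metric.ball 0 r ∪ A ∪ R, fun s => H s / Q s, (Metric.isOpen_ball.union hAo).union hRo,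
    ⟨⟨0, Or.inl (Or.inl (Metric.mem_ball_self hr))⟩, ?_⟩,
    Or.inl (Or.inl (Metric.mem_ball_self hr)), subset_union_right, fun s hs => ?_, fun s hs => ?_⟩
  · refine IsPreconnected.union' (s := Metric.ball 0 r ∪ A) ?_ (IsPreconnected.union' ?_
      (convex_ball _ _).isPreconnected hAc.isPreconnected) hRc.isPreconnected
    · refine ⟨⟨p + 2, 1⟩, Or.inr ⟨?_, ?_⟩, ?_⟩
      · change -1 < (p : ℝ) + 2
        linarith
      · exact one_pos (α := ℝ)
      · change (p : ℝ) + 1 < p + 2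
        linarith
    · refine ⟨⟨0, r / 2⟩, ?_, ?_, ?_⟩
      · have : (⟨0, r / 2⟩ : ℂ) = ((r / 2 : ℝ) : ℂ) * Complex.I := by
          apply Complex.ext <;> simp
        rw [mem_ball_zero_iff, this, norm_mul, Complex.norm_I, Complex.norm_real, mul_one,
          Real.norm_of_nonneg (by positivity)]
        linarith
      · change (-1 : ℝ) < 0
        norm_num
      · change 0 < r / 2
        positivity
  · exact ((hH.differentiableAt (hopen.mem_nhds (hU s hs).2)).div (hQ s)
      (hU s hs).1).differentiableWithinAt
  · change H s / Q s = g s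
    rw [← (hQH s hs).2, mul_div_cancel_left₀ _ (hQH s hs).1]

/-- A function that is, up to any vertical line, a quotient of holomorphic functions with numerator
vanishing at `0` and denominator nonzero there can only be extended to `0` by `0`. -/
lemma extension_zero_eq_zero (p : ℕ) {g : ℂ → ℂ}
    (hg : ∀ K : ℕ, ∃ Q H : ℂ → ℂ, Differentiable ℂ Q ∧
      DifferentiableOn ℂ H {s | -(K : ℝ) < s.re} ∧ Q 0 ≠ 0 ∧ H 0 = 0 ∧
      ∀ s : ℂ, (p : ℝ) + 1 < s.re → Q s * g s = H s)
    {U : Set ℂ} {G : ℂ → ℂ} (hU : IsOpen U) (hUc : IsConnected U) (h0 : (0 : ℂ) ∈ U)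
    (hsub : {s : ℂ | (p : ℝ) + 1 < s.re} ⊆ U) (hG : DifferentiableOn ℂ G U)
    (hGg : ∀ s : ℂ, (p : ℝ) + 1 < s.re → G s = g s) : G 0 = 0 := by
  have hbR : ((p : ℂ) + 2) ∈ {s : ℂ | (p : ℝ) + 1 < s.re} := by simp
  obtain ⟨γ, hγ⟩ := ((hU.isConnected_iff_isPathConnected).1 hUc).joinedIn 0 h0 _ (hsub hbR)
  obtain ⟨m, hm⟩ := (isCompact_range (Complex.continuous_re.comp γ.continuous)).bddBelow
  obtain ⟨K, hK⟩ := exists_nat_gt (-m)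
  obtain ⟨Q, H, hQ, hH, hQ0, hH0, hQH⟩ := hg K
  have hopen : IsOpen {s : ℂ | -(K : ℝ) < s.re} :=
    isOpen_lt continuous_const Complex.continuous_re
  set V := U ∩ {s : ℂ | -(K : ℝ) < s.re} with hV
  have hrange : range γ ⊆ V := by
    rintro _ ⟨t, rfl⟩
    refine ⟨hγ t, ?_⟩
    have : m ≤ (γ t).re := hm ⟨t, rfl⟩
    change -(K : ℝ) < (γ t).re
    linarith
  have hmem0 : (0 : ℂ) ∈ range γ := ⟨0, γ.source⟩
  set W := connectedComponentIn V 0 with hW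
  have hWo : IsOpen W := (hU.inter hopen).connectedComponentIn
  have hWV : W ⊆ V := connectedComponentIn_subset _ _
  have hγW : range γ ⊆ W :=
    (isPreconnected_range γ.continuous).subset_connectedComponentIn hmem0 hrange
  have hF : AnalyticOnNhd ℂ (fun s => Q s * G s) W :=
    (hQ.differentiableOn.mul (hG.mono (hWV.trans inter_subset_left))).analyticOnNhd hWo
  have hHa : AnalyticOnNhd ℂ H W := (hH.mono (hWV.trans inter_subset_right)).analyticOnNhd hWo
  have heq := hF.eqOn_of_preconnected_of_eventuallyEq hHa isPreconnected_connectedComponentIn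
    (hγW ⟨1, γ.target⟩) (by
      filter_upwards [(isOpen_lt continuous_const Complex.continuous_re).mem_nhds hbR] with s hs
      rw [hGg s hs, hQH s hs]) (hγW hmem0)
  simp only [hH0] at heq
  exact (mul_eq_zero.1 heq).resolve_left hQ0

/-- Lemma 1: the integral `g(s)` converges for `Re s > p + 1`, extends holomorphically to `0`,
and every holomorphic extension to an open connected set containing `0` and the half-plane
`{s : Re s > p + 1}` vanishes at `0`. -/
theorem lemma_one
    (n : ℕ) (hn : 1 ≤ n) (x : Fin n → ℂ) (hre : ∀ i, (x i).re < 0) (p : ℕ) :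
    (∀ s : ℂ, (p : ℝ) + 1 < s.re →
        MeasureTheory.IntegrableOn (lemmaOneIntegrand n x p s) (Set.Ioi 0)) ∧
    (∃ U : Set ℂ, ∃ G : ℂ → ℂ, IsOpen U ∧ IsConnected U ∧ (0 : ℂ) ∈ U ∧
        {s : ℂ | (p : ℝ) + 1 < s.re} ⊆ U ∧ DifferentiableOn ℂ G U ∧
        ∀ s : ℂ, (p : ℝ) + 1 < s.re → G s = lemmaOneG n x p s) ∧
    (∀ U : Set ℂ, ∀ G : ℂ → ℂ, IsOpen U → IsConnected U → (0 : ℂ) ∈ U →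
        {s : ℂ | (p : ℝ) + 1 < s.re} ⊆ U → DifferentiableOn ℂ G U →
        (∀ s : ℂ, (p : ℝ) + 1 < s.re → G s = lemmaOneG n x p s) →
        G 0 = 0) := by
  refine ⟨fun s hs => integrableOn_lemmaOneIntegrand hn hre hs, ?_, ?_⟩
  · obtain ⟨Q, H, hQ, hH, hQ0, -, hQim, hQH⟩ := exists_mul_lemmaOneG_eq hn hre p 1
    exact exists_connected_extension p hQ (by simpa using hH) hQ0 hQim hQH
  · intro U G hU hUc h0 hsub hG hGg
    exact extension_zero_eq_zero p (fun K => by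
      obtain ⟨Q, H, hQ, hH, hQ0, hH0, -, hQH⟩ := exists_mul_lemmaOneG_eq hn hre p K
      exact ⟨Q, H, hQ, hH, hQ0, hH0, fun s hs => (hQH s hs).2⟩) hU hUc h0 hsub hG hGg
end

section
/- (Lemma 2.) Define F^{(p)}(s) = ∫_0^∞ x^p · [ log P^0(x) · P^0(x)^{−s} − Σ_{i=1}^n Log(x − x_i) · (x − x_i)^{−s} ] dx, which converges for Re s > p + 1. Then F^{(p)} extends holomorphically to 0, and every holomorphic extension G of F^{(p)} to an open connected set containing 0 and the half-plane {s : Re s > p + 1} satisfies G(0) = −(1/(2n)) Σ_{l=1}^{p} [ (1/(l(p+1−l))) · (Σ_{i=1}^n x_i^l)(Σ_{j=1}^n x_j^{p−l+1}) ] + (H_p/(p+1)) · Σ_{i=1}^n x_i^{p+1}, where H_p = Σ_{i=1}^p 1/i is the p-th harmonic number (H_0 = 0). In particular for p = 0 the value at 0 is 0. -/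
/-- The integrand of Lemma 2:
`xᵖ · [ log P⁰(x) · P⁰(x)^{−s} − Σᵢ Log(x − xᵢ) · (x − xᵢ)^{−s} ]`, where
`log P⁰(x) = Σᵢ Log(x − xᵢ)` and `P⁰(x)^{−s} = exp(−s · log P⁰(x))`. -/
noncomputable def lemmaTwoIntegrand (n : ℕ) (x : Fin n → ℂ) (p : ℕ) (s : ℂ) (t : ℝ) : ℂ :=
  (t : ℂ) ^ p *
    ((∑ i : Fin n, Complex.log ((t : ℂ) - x i)) *
        Complex.exp (-s * ∑ i : Fin n, Complex.log ((t : ℂ) - x i))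
      - ∑ i : Fin n, Complex.log ((t : ℂ) - x i) * Complex.exp (-s * Complex.log ((t : ℂ) - x i)))

/-- `F⁽ᵖ⁾(s) = ∫₀^∞ xᵖ · [ log P⁰(x) · P⁰(x)^{−s} − Σᵢ Log(x − xᵢ)(x − xᵢ)^{−s} ] dx`. -/
noncomputable def lemmaTwoF (n : ℕ) (x : Fin n → ℂ) (p : ℕ) (s : ℂ) : ℂ :=
  ∫ t in Set.Ioi (0 : ℝ), lemmaTwoIntegrand n x p s t

section
open Complex Filter Topology MeasureTheory Set

/-- A meromorphic function which has a limit at `0` and is continuous on `Re s > c` agrees there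
with a holomorphic function on a connected open set containing `0` and this half-plane. -/
theorem meromorphic_extension_exists {M : ℂ → ℂ} (hM : ∀ z, MeromorphicAt M z) {c : ℝ}
    (hc : 0 ≤ c) {v : ℂ}
    (hv : Tendsto M (𝓝[≠] 0) (𝓝 v)) (hF : ∀ s : ℂ, c < s.re → ContinuousAt M s) :
    ∃ U : Set ℂ, ∃ G : ℂ → ℂ, IsOpen U ∧ IsConnected U ∧ (0 : ℂ) ∈ U ∧
        {s : ℂ | c < s.re} ⊆ U ∧ DifferentiableOn ℂ G U ∧ ∀ s : ℂ, c < s.re → G s = M s := by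
  have hG : Meromorphic (Function.update M 0 v) := fun z => (hM z).update 0 v
  refine ⟨{z | AnalyticAt ℂ (Function.update M 0 v) z}, Function.update M 0 v,
    isOpen_analyticAt ℂ _, ?_, ?_, ?_, fun z hz => ?_, fun s hs => ?_⟩
  · have := (hG.meromorphicOn (s := univ)).countable_compl_analyticAt_inter
    rw [inter_univ] at this
    have h2 := this.isConnected_compl_of_one_lt_rank (E := ℂ) (by
      rw [Complex.rank_real_complex]; norm_num)
    rwa [compl_compl] at h2
  · exact (hG 0).analyticAt (continuousAt_update_same.2 hv)
  · intro s hs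
    have hs0 : s ≠ 0 := by rintro rfl; simp at hs; linarith
    exact (hG s).analyticAt ((continuousAt_update_of_ne hs0).2 (hF s hs))
  · have hza : AnalyticAt ℂ (Function.update M 0 v) z := hz
    exact hza.differentiableAt.differentiableWithinAt
  · have hs0 : s ≠ 0 := by rintro rfl; simp at hs; linarith
    simp [hs0]

theorem eq_of_meromorphic_extension {M : ℂ → ℂ} (hM : ∀ z, MeromorphicAt M z) {c : ℝ} {v : ℂ}
    (hv : Tendsto M (𝓝[≠] 0) (𝓝 v)) {U : Set ℂ} {G : ℂ → ℂ} (hU : IsOpen U)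
    (hU' : IsConnected U) (h0 : (0 : ℂ) ∈ U) (hUc : {s : ℂ | c < s.re} ⊆ U)
    (hG : DifferentiableOn ℂ G U) (hGM : ∀ s : ℂ, c < s.re → G s = M s) : G 0 = v := by
  have hGa : ∀ z ∈ U, AnalyticAt ℂ G z := fun z hz => hG.analyticAt (hU.mem_nhds hz)
  have hD : MeromorphicOn (G - M) U := fun z hz => (hGa z hz).meromorphicAt.sub (hM z)
  have hy : ((c + 1 : ℝ) : ℂ) ∈ {s : ℂ | c < s.re} := by simp
  have htop : meromorphicOrderAt (G - M) 0 = ⊤ := by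
    by_contra h
    refine hD.meromorphicOrderAt_ne_top_of_isPreconnected hU'.isPreconnected h0 (hUc hy) h ?_
    rw [meromorphicOrderAt_eq_top_iff]
    refine eventually_nhdsWithin_of_eventually_nhds ?_
    filter_upwards [(isOpen_lt continuous_const Complex.continuous_re).mem_nhds hy] with z hz
    simp [hGM z hz]
  rw [meromorphicOrderAt_eq_top_iff] at htop
  have h1 : Tendsto G (𝓝[≠] 0) (𝓝 (G 0)) :=
    (hGa 0 h0).continuousAt.tendsto.mono_left nhdsWithin_le_nhds
  refine tendsto_nhds_unique (h1.congr' ?_) hv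
  filter_upwards [htop] with z hz using sub_eq_zero.1 hz

theorem tendsto_deriv_of_hasDerivWithinAt {f g : ℂ → ℂ} (hf : MeromorphicAt f 0) {b : ℂ}
    (hfg : EqOn f g {s | 0 < s.re}) (hg : HasDerivWithinAt g b {s | 0 < s.re} 0) :
    Tendsto (deriv f) (𝓝[≠] 0) (𝓝 b) := by
  set S : Set ℂ := {s | 0 < s.re}
  have hS : 𝓝[S] (0 : ℂ) ≤ 𝓝[≠] 0 := nhdsWithin_mono _ (by
    rintro z hz rfl; simp [S] at hz)
  have : (𝓝[S] (0 : ℂ)).NeBot := by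
    rw [← mem_closure_iff_nhdsWithin_neBot]
    simp [S]
  have hfS : Tendsto f (𝓝[S] 0) (𝓝 (g 0)) :=
    hg.continuousWithinAt.tendsto.congr' (eventually_nhdsWithin_of_forall fun z hz => (hfg hz).symm)
  have hord : 0 ≤ meromorphicOrderAt f 0 := by
    by_contra! h
    have := (tendsto_cobounded_of_meromorphicOrderAt_neg h).mono_left hS
    exact hfS.not_tendsto (Metric.disjoint_nhds_cobounded _) this
  obtain ⟨c, hc⟩ := tendsto_nhds_of_meromorphicOrderAt_nonneg hf hord
  have hcg : c = g 0 := tendsto_nhds_unique (hc.mono_left hS) hfS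
  subst hcg
  have ha : AnalyticAt ℂ (Function.update f 0 (g 0)) 0 :=
    (hf.update 0 (g 0)).analyticAt (continuousAt_update_same.2 hc)
  have hd : HasDerivWithinAt g (deriv (Function.update f 0 (g 0)) 0) S 0 := by
    refine ha.differentiableAt.hasDerivAt.hasDerivWithinAt.congr (fun z hz => ?_) (by simp)
    have : z ≠ 0 := by rintro rfl; simp [S] at hz
    simp [this, hfg hz]
  have hb : deriv (Function.update f 0 (g 0)) 0 = b := by
    rw [hasDerivWithinAt_iff_tendsto_slope' (by simp [S])] at hd hg
    exact tendsto_nhds_unique hd hg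
  rw [← hb]
  refine (ha.deriv.continuousAt.tendsto.mono_left nhdsWithin_le_nhds).congr' ?_
  filter_upwards [self_mem_nhdsWithin] with z hz
  refine Filter.EventuallyEq.deriv_eq ?_
  filter_upwards [isOpen_compl_singleton.mem_nhds hz] with w hw
  have : w ≠ 0 := hw
  simp [this]

/-- The logarithm `∑ᵢ Log(t − xᵢ)` of `∏ᵢ (t − xᵢ)`. -/
noncomputable def logSum {n : ℕ} (x : Fin n → ℂ) (t : ℝ) : ℂ :=
  ∑ i : Fin n, Complex.log ((t : ℂ) - x i)

theorem Complex.norm_log_sub_log_le {m : ℝ} (hm : 0 < m) {z w : ℂ} (hz : m ≤ z.re)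
    (hw : m ≤ w.re) :
    ‖log z - log w‖ ≤ ‖z - w‖ / m := by
  have hconv : Convex ℝ {z : ℂ | m ≤ z.re} := convex_halfSpace_re_ge m
  have := hconv.norm_image_sub_le_of_norm_hasDerivWithin_le (f := log) (f' := fun z => z⁻¹)
    (C := m⁻¹) (x := w) (y := z) (𝕜 := ℂ)
    (fun u hu => (hasDerivAt_log (Or.inl (hm.trans_le hu))).hasDerivWithinAt)
    (fun u hu => by
      rw [norm_inv]
      exact inv_anti₀ hm ((show m ≤ u.re from hu).trans (re_le_norm u))) hw hz
  rwa [div_eq_inv_mul]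

section
variable {n : ℕ} {x : Fin n → ℂ}

theorem exists_le_re_sub (hre : ∀ i, (x i).re < 0) :
    ∃ c : ℝ, 0 < c ∧ c ≤ 1 ∧ ∀ i, ∀ t : ℝ, 0 ≤ t → c * (1 + t) ≤ ((t : ℂ) - x i).re := by
  obtain ⟨c, hc, hcx⟩ : ∃ c : ℝ, 0 < c ∧ ∀ i, c ≤ -(x i).re := by
    rcases isEmpty_or_nonempty (Fin n) with h | h
    · exact ⟨1, one_pos, fun i => h.elim i⟩
    · obtain ⟨i, hi⟩ := Finite.exists_min (fun i => -(x i).re)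
      exact ⟨_, by linarith [hre i], hi⟩
  refine ⟨min c 1, lt_min hc one_pos, min_le_right _ _, fun i t ht => ?_⟩
  have h1 := hcx i
  have h2 := min_le_left c 1
  have h3 := mul_le_mul_of_nonneg_right (min_le_right c 1) ht
  simp only [sub_re, ofReal_re]
  linarith

theorem sub_re_pos (hre : ∀ i, (x i).re < 0) (i : Fin n) {t : ℝ} (ht : 0 ≤ t) :
    0 < ((t : ℂ) - x i).re := by
  simp only [sub_re, ofReal_re]
  linarith [hre i]

theorem ofReal_sub_ne_zero (hre : ∀ i, (x i).re < 0) (i : Fin n) {t : ℝ} (ht : 0 ≤ t) :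
    (t : ℂ) - x i ≠ 0 := by
  intro h
  have := sub_re_pos hre i ht
  simp [h] at this

theorem hasDerivAt_logSum (hre : ∀ i, (x i).re < 0) {t : ℝ} (ht : 0 ≤ t) :
    HasDerivAt (logSum x) (∑ i, 1 / ((t : ℂ) - x i)) t :=
  HasDerivAt.fun_sum fun i _ =>
    ((hasDerivAt_id t).ofReal_comp.sub_const (x i)).clog_real (Or.inl (sub_re_pos hre i ht))

theorem continuousOn_logSum (hre : ∀ i, (x i).re < 0) : ContinuousOn (logSum x) (Ici 0) :=
  fun _ ht => (hasDerivAt_logSum hre ht).continuousAt.continuousWithinAt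

theorem exp_logSum (hre : ∀ i, (x i).re < 0) {t : ℝ} (ht : 0 ≤ t) :
    exp (logSum x t) = ∏ i, ((t : ℂ) - x i) := by
  rw [logSum, exp_sum]
  exact Finset.prod_congr rfl fun i _ => exp_log (ofReal_sub_ne_zero hre i ht)

theorem exists_norm_log_sub_le (hre : ∀ i, (x i).re < 0) :
    ∃ C : ℝ, 0 ≤ C ∧ ∀ i, ∀ t : ℝ, 0 ≤ t →
      ‖log ((t : ℂ) - x i) - (Real.log (1 + t) : ℝ)‖ ≤ C / (1 + t) := by
  obtain ⟨c, hc, hc1, hcx⟩ := exists_le_re_sub hre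
  refine ⟨(∑ i, ‖-x i - 1‖) / c, by positivity, fun i t ht => ?_⟩
  have h1 : 0 < 1 + t := by linarith
  have h2 := norm_log_sub_log_le (mul_pos hc h1) (hcx i t ht) (w := ((1 + t : ℝ) : ℂ))
    (by rw [ofReal_re]; nlinarith)
  rw [ofReal_log h1.le, div_div]
  refine h2.trans (div_le_div_of_nonneg_right ?_ (by positivity))
  have h3 : (t : ℂ) - x i - ((1 + t : ℝ) : ℂ) = -x i - 1 := by push_cast; ring
  rw [h3]
  exact Finset.single_le_sum (f := fun i => ‖-x i - 1‖) (fun _ _ => norm_nonneg _)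
    (Finset.mem_univ i)

theorem exists_norm_logSum_sub_le (hre : ∀ i, (x i).re < 0) :
    ∃ C : ℝ, 0 ≤ C ∧ (∀ t : ℝ, 0 ≤ t → ‖logSum x t - n * (Real.log (1 + t) : ℝ)‖ ≤ C / (1 + t)) ∧
      ∀ i, ∀ t : ℝ, 0 ≤ t → ‖logSum x t - n * log ((t : ℂ) - x i)‖ ≤ C / (1 + t) := by
  obtain ⟨C, hC, h⟩ := exists_norm_log_sub_le hre
  have key : ∀ t : ℝ, 0 ≤ t →
      ‖logSum x t - n * (Real.log (1 + t) : ℝ)‖ ≤ n * C / (1 + t) := by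
    intro t ht
    have h1 : logSum x t - n * (Real.log (1 + t) : ℝ) =
        ∑ i, (log ((t : ℂ) - x i) - (Real.log (1 + t) : ℝ)) := by
      simp [logSum, Finset.sum_sub_distrib]
    rw [h1]
    refine (norm_sum_le _ _).trans ((Finset.sum_le_sum fun i _ => h i t ht).trans ?_)
    simp [mul_div_assoc]
  refine ⟨n * C + n * C, by positivity, fun t ht => (key t ht).trans ?_, fun i t ht => ?_⟩
  · have : 0 < 1 + t := by linarith
    gcongr
    have : 0 ≤ n * C := by positivity
    linarith
  · have h1 : logSum x t - n * log ((t : ℂ) - x i) = (logSum x t - n * (Real.log (1 + t) : ℝ))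
        - n * (log ((t : ℂ) - x i) - (Real.log (1 + t) : ℝ)) := by ring
    rw [h1]
    refine (norm_sub_le _ _).trans ?_
    rw [add_div, norm_mul, Complex.norm_natCast]
    refine add_le_add (key t ht) ?_
    rw [mul_div_assoc]
    exact mul_le_mul_of_nonneg_left (h i t ht) (by positivity)

theorem norm_exp_neg_mul_le {N : ℝ} {C t : ℝ} (hC : 0 ≤ C) (ht : 0 ≤ t) {L : ℂ}
    (hL : ‖L - N * (Real.log (1 + t) : ℝ)‖ ≤ C / (1 + t)) (s : ℂ) :
    ‖exp (-s * L)‖ ≤ Real.exp (‖s‖ * C) * (1 + t) ^ (-(N * s.re)) := by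
  have h1 : 0 < 1 + t := by linarith
  have h2 : -s * L = -s * (L - N * (Real.log (1 + t) : ℝ)) + -s * (N * (Real.log (1 + t) : ℝ)) := by
    ring
  rw [h2, exp_add, norm_mul]
  refine mul_le_mul ?_ ?_ (norm_nonneg _) (Real.exp_pos _).le
  · refine (norm_exp_le_exp_norm _).trans (Real.exp_le_exp.2 ?_)
    rw [norm_mul, norm_neg]
    refine mul_le_mul_of_nonneg_left (hL.trans (div_le_self hC (by linarith))) (norm_nonneg _)
  · rw [norm_exp, Real.rpow_def_of_pos h1]
    refine (congrArg Real.exp ?_).le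
    simp [← ofReal_mul]
    ring

theorem hasDerivAt_integral_exp_logSum (hre : ∀ i, (x i).re < 0) {w : ℝ → ℂ}
    (hw : ContinuousOn w (Ioi 0)) {A q : ℝ} (hA : ∀ t : ℝ, 0 < t → ‖w t‖ ≤ A * (1 + t) ^ q)
    {s : ℂ} (hs : q + 1 < n * s.re) :
    IntegrableOn (fun t => w t * exp (-s * logSum x t)) (Ioi 0) ∧
    IntegrableOn (fun t => w t * (logSum x t * exp (-s * logSum x t))) (Ioi 0) ∧
    HasDerivAt (fun s => ∫ t in Ioi (0 : ℝ), w t * exp (-s * logSum x t))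
      (-∫ t in Ioi (0 : ℝ), w t * (logSum x t * exp (-s * logSum x t))) s := by
  obtain ⟨C, hC, hCx, -⟩ := exists_norm_logSum_sub_le hre
  have hA0 : 0 ≤ A := by
    have h1 := (norm_nonneg _).trans (hA 1 one_pos)
    exact nonneg_of_mul_nonneg_left h1 (by positivity)
  have hcont : ContinuousOn (logSum x) (Ioi 0) := (continuousOn_logSum hre).mono Ioi_subset_Ici_self
  have hmeas : ∀ u : ℂ, AEStronglyMeasurable (fun t => w t * exp (-u * logSum x t))
      (volume.restrict (Ioi 0)) := fun u =>
    (hw.mul (hcont.const_mul (-u)).cexp).aestronglyMeasurable measurableSet_Ioi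
  have hint : ∀ a : ℝ, a < -1 → IntegrableOn (fun t : ℝ => (1 + t) ^ a) (Ioi 0) := by
    intro a ha
    simpa only [add_comm] using integrableOn_add_rpow_Ioi_of_lt (m := 1) (c := 0) ha (by norm_num)
  have hI : IntegrableOn (fun t => w t * exp (-s * logSum x t)) (Ioi 0) := by
    refine Integrable.mono' ((hint (q - n * s.re) (by linarith)).const_mul
      (A * Real.exp (‖s‖ * C))) (hmeas s) ?_
    filter_upwards [ae_restrict_mem measurableSet_Ioi] with t ht
    have ht0 : (0 : ℝ) < t := ht
    have h1 : 0 < 1 + t := by linarith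
    rw [norm_mul]
    refine (mul_le_mul (hA t ht) (norm_exp_neg_mul_le (N := n) hC ht0.le
      (by simpa using hCx t ht0.le) s) (norm_nonneg _) (by positivity)).trans (le_of_eq ?_)
    rw [sub_eq_add_neg, Real.rpow_add h1]
    ring
  obtain ⟨r, hr, hr1⟩ : ∃ r : ℝ, 0 < r ∧ q + r - n * (s.re - r) < -1 := by
    refine ⟨(n * s.re - q - 1) / (2 * (n + 1)), div_pos (by linarith) (by positivity), ?_⟩
    have : (n + 1) * ((n * s.re - q - 1) / (2 * (n + 1))) = (n * s.re - q - 1) / 2 := by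
      field_simp
    nlinarith
  have key := hasDerivAt_integral_of_dominated_loc_of_deriv_le (μ := volume.restrict (Ioi (0 : ℝ)))
    (F := fun u t => w t * exp (-u * logSum x t))
    (F' := fun u t => -(w t * (logSum x t * exp (-u * logSum x t))))
    (bound := fun t => (A * ((n / r + C) * Real.exp ((‖s‖ + r) * C))) *
      (1 + t) ^ (q + r - n * (s.re - r)))
    (x₀ := s) (Metric.ball_mem_nhds s hr) (Eventually.of_forall hmeas) hI
    ((hw.mul (hcont.mul (hcont.const_mul (-s)).cexp)).aestronglyMeasurable measurableSet_Ioi).neg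
    ?_ ((hint _ hr1).const_mul _) ?_
  · refine ⟨hI, by simpa using! key.1.neg, ?_⟩
    rw [← integral_neg]
    exact key.2
  · filter_upwards [ae_restrict_mem measurableSet_Ioi] with t ht u hu
    have ht0 : (0 : ℝ) < t := ht
    have h1 : 0 < 1 + t := by linarith
    have hus : ‖u - s‖ < r := by simpa [dist_eq_norm] using hu
    have hu1 : ‖u‖ ≤ ‖s‖ + r := by
      have := norm_le_norm_add_norm_sub' u s
      linarith
    have hu2 : s.re - r ≤ u.re := by
      have := (abs_re_le_norm (u - s)).trans hus.le
      rw [sub_re] at this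
      linarith [(abs_le.1 this).1]
    have hL : ‖logSum x t‖ ≤ (n / r + C) * (1 + t) ^ r := by
      have h2 : ‖logSum x t‖ ≤ n * Real.log (1 + t) + C / (1 + t) := by
        have h3 := norm_le_norm_add_norm_sub' (logSum x t) (n * (Real.log (1 + t) : ℝ))
        have h4 : ‖(n : ℂ) * (Real.log (1 + t) : ℝ)‖ = n * Real.log (1 + t) := by
          rw [norm_mul, Complex.norm_natCast, norm_real,
            Real.norm_of_nonneg (Real.log_nonneg (by linarith))]
        linarith [hCx t ht0.le]
      have h5 := Real.log_le_rpow_div h1.le hr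
      have h6 : C / (1 + t) ≤ C * (1 + t) ^ r :=
        (div_le_self hC (by linarith)).trans
          (le_mul_of_one_le_right hC (Real.one_le_rpow (by linarith) hr.le))
      have h7 := mul_le_mul_of_nonneg_left h5 (Nat.cast_nonneg (α := ℝ) n)
      calc ‖logSum x t‖ ≤ n * ((1 + t) ^ r / r) + C * (1 + t) ^ r := by linarith
        _ = _ := by ring
    have hE : ‖exp (-u * logSum x t)‖ ≤
        Real.exp ((‖s‖ + r) * C) * (1 + t) ^ (-(n * (s.re - r))) := by
      refine (norm_exp_neg_mul_le (N := n) hC ht0.le (by simpa using hCx t ht0.le) u).trans ?_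
      gcongr
      linarith
    rw [norm_neg, norm_mul, norm_mul]
    calc _ ≤ (A * (1 + t) ^ q) * (((n / r + C) * (1 + t) ^ r) *
          (Real.exp ((‖s‖ + r) * C) * (1 + t) ^ (-(n * (s.re - r))))) := by
          gcongr
          exact hA t ht0
      _ = _ := by
          rw [sub_eq_add_neg (q + r), Real.rpow_add h1, Real.rpow_add h1]
          ring
  · filter_upwards with t u _
    have h1 : HasDerivAt (fun u : ℂ => w t * exp (-u * logSum x t))
        (w t * (exp (-u * logSum x t) * (-1 * logSum x t))) u :=
      ((hasDerivAt_id u).neg.mul_const (logSum x t)).cexp.const_mul (w t)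
    exact h1.congr_deriv (by ring)

end

/-- The integral `∫₀^∞ t^q exp(−s·logSum x t) dt`. -/
noncomputable def powInt {n : ℕ} (x : Fin n → ℂ) (q : ℕ) (s : ℂ) : ℂ :=
  ∫ t in Ioi (0 : ℝ), (t : ℂ) ^ q * exp (-s * logSum x t)

/-- The integral `∫₀^∞ (t − xᵢ)⁻¹ exp(−s·logSum x t) dt`. -/
noncomputable def poleInt {n : ℕ} (x : Fin n → ℂ) (i : Fin n) (s : ℂ) : ℂ :=
  ∫ t in Ioi (0 : ℝ), 1 / ((t : ℂ) - x i) * exp (-s * logSum x t)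

/-- The solution of the recursion satisfied by `q ↦ powInt x q s`, with the values
`s * poleInt x i s` replaced by parameters `E i`. -/
noncomputable def reduction {n : ℕ} (x : Fin n → ℂ) (s : ℂ) (E : Fin n → ℂ) : ℕ → ℂ
  | q => (s * ∑ m : Fin q, (∑ i, x i ^ (q - m)) * reduction x s E m + ∑ i, x i ^ (q + 1) * E i) /
      (q + 1 - n * s)

section
variable {n : ℕ} {x : Fin n → ℂ}

theorem hasDerivAt_powInt (hre : ∀ i, (x i).re < 0) {q : ℕ} {s : ℂ} (hs : q + 1 < n * s.re) :
    IntegrableOn (fun t : ℝ => (t : ℂ) ^ q * exp (-s * logSum x t)) (Ioi 0) ∧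
    IntegrableOn (fun t : ℝ => (t : ℂ) ^ q * (logSum x t * exp (-s * logSum x t))) (Ioi 0) ∧
    HasDerivAt (powInt x q)
      (-∫ t in Ioi (0 : ℝ), (t : ℂ) ^ q * (logSum x t * exp (-s * logSum x t))) s := by
  refine hasDerivAt_integral_exp_logSum hre (w := fun t : ℝ => (t : ℂ) ^ q) (by fun_prop)
    (A := 1) (q := q) (fun t ht => ?_) hs
  rw [norm_pow, norm_real, Real.norm_of_nonneg ht.le, one_mul, Real.rpow_natCast]
  exact pow_le_pow_left₀ ht.le (by linarith) q

theorem norm_one_div_sub_le {c : ℝ} (hc : 0 < c) {i : Fin n} {t : ℝ} (ht : 0 ≤ t)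
    (h : c * (1 + t) ≤ ((t : ℂ) - x i).re) : ‖1 / ((t : ℂ) - x i)‖ ≤ c⁻¹ * (1 + t) ^ (-1 : ℝ) := by
  have h1 : 0 < 1 + t := by linarith
  rw [Real.rpow_neg_one, ← mul_inv, norm_div, norm_one, one_div]
  exact inv_anti₀ (by positivity) (h.trans (re_le_norm _))

theorem continuousOn_one_div_sub (hre : ∀ i, (x i).re < 0) (i : Fin n) :
    ContinuousOn (fun t : ℝ => 1 / ((t : ℂ) - x i)) (Ioi 0) :=
  continuousOn_const.div (by fun_prop) fun _ ht => ofReal_sub_ne_zero hre i (le_of_lt ht)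

theorem hasDerivAt_poleInt (hre : ∀ i, (x i).re < 0) (i : Fin n) {s : ℂ} (hs : 0 < s.re) :
    IntegrableOn (fun t : ℝ => 1 / ((t : ℂ) - x i) * exp (-s * logSum x t)) (Ioi 0) ∧
    DifferentiableAt ℂ (poleInt x i) s := by
  obtain ⟨c, hc, -, hcx⟩ := exists_le_re_sub hre
  have hn : (0 : ℝ) < n := by exact_mod_cast i.pos
  have := hasDerivAt_integral_exp_logSum hre (continuousOn_one_div_sub hre i)
    (A := c⁻¹) (q := -1) (fun t ht => norm_one_div_sub_le hc ht.le (hcx i t ht.le)) (s := s)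
    (by rw [neg_add_cancel]; positivity)
  exact ⟨this.1, this.2.2.differentiableAt⟩

theorem tendsto_pow_mul_exp_logSum (hre : ∀ i, (x i).re < 0) {q : ℕ} {s : ℂ} (hs : q < n * s.re) :
    Tendsto (fun t : ℝ => (t : ℂ) ^ q * exp (-s * logSum x t)) atTop (𝓝 0) := by
  obtain ⟨C, hC, hCx, -⟩ := exists_norm_logSum_sub_le hre
  have h1 : Tendsto (fun t : ℝ => Real.exp (‖s‖ * C) * (1 + t) ^ (-(n * s.re - q))) atTop (𝓝 0) := by
    simpa using (((tendsto_rpow_neg_atTop (sub_pos.2 hs)).comp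
      (tendsto_atTop_add_const_left atTop (1 : ℝ) tendsto_id)).const_mul (Real.exp (‖s‖ * C)))
  refine squeeze_zero_norm' ?_ h1
  filter_upwards [eventually_gt_atTop 0] with t ht
  have h0 : 0 < 1 + t := by linarith
  have h2 := norm_exp_neg_mul_le (N := n) hC ht.le (by simpa using hCx t ht.le) s
  have h3 : ‖(t : ℂ) ^ q‖ ≤ (1 + t) ^ (q : ℝ) := by
    rw [norm_pow, norm_real, Real.norm_of_nonneg ht.le, Real.rpow_natCast]
    exact pow_le_pow_left₀ ht.le (by linarith) q
  rw [norm_mul]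
  refine (mul_le_mul h3 h2 (norm_nonneg _) (by positivity)).trans (le_of_eq ?_)
  rw [neg_sub, sub_eq_add_neg, Real.rpow_add h0]
  ring

theorem hasDerivAt_exp_logSum (hre : ∀ i, (x i).re < 0) (s : ℂ) {t : ℝ} (ht : 0 ≤ t) :
    HasDerivAt (fun t => exp (-s * logSum x t))
      (exp (-s * logSum x t) * (-s * ∑ i, 1 / ((t : ℂ) - x i))) t :=
  ((hasDerivAt_logSum hre ht).const_mul (-s)).cexp

theorem mul_sum_poleInt (hre : ∀ i, (x i).re < 0) (hn : 1 ≤ n) {s : ℂ} (hs : 0 < s.re) :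
    s * ∑ i, poleInt x i s = exp (-s * logSum x 0) := by
  have hn' : (0 : ℝ) < n := by exact_mod_cast hn
  have hint := fun i => (hasDerivAt_poleInt hre i hs).1
  have key := integral_Ioi_of_hasDerivAt_of_tendsto' (a := 0)
    (f' := fun t : ℝ => -s * ∑ i, 1 / ((t : ℂ) - x i) * exp (-s * logSum x t))
    (fun t ht => (hasDerivAt_exp_logSum hre s ht).congr_deriv (by rw [← Finset.sum_mul]; ring))
    ((integrable_finsetSum _ fun i _ => hint i).const_mul _)
    (by simpa using tendsto_pow_mul_exp_logSum hre (q := 0) (s := s) (by simpa using by positivity))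
  rw [integral_const_mul, integral_finsetSum _ fun i _ => hint i] at key
  have h2 : -s * ∑ i, poleInt x i s = 0 - exp (-s * logSum x 0) := key
  linear_combination -h2

theorem pow_div_sub (a b : ℂ) (h : a - b ≠ 0) (q : ℕ) :
    a ^ (q + 1) * (1 / (a - b)) =
      a ^ q + ∑ m : Fin q, b ^ (q - m) * a ^ (m : ℕ) + b ^ (q + 1) * (1 / (a - b)) := by
  have h1 := geom_sum₂_mul a b (q + 1)
  rw [Finset.sum_range_succ, Finset.sum_range] at h1
  simp only [Nat.add_sub_cancel, Nat.sub_self, pow_zero, mul_one] at h1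
  have h2 : ∑ m : Fin q, b ^ (q - m) * a ^ (m : ℕ) = ∑ m : Fin q, a ^ (m : ℕ) * b ^ (q - m) :=
    Finset.sum_congr rfl fun _ _ => mul_comm _ _
  rw [h2]
  field_simp
  linear_combination -h1

theorem mul_powInt (hre : ∀ i, (x i).re < 0) {q : ℕ} {s : ℂ} (hs : q + 1 < n * s.re)
    (hs0 : 0 < s.re) :
    (q + 1 - n * s) * powInt x q s =
      s * ∑ m : Fin q, (∑ i, x i ^ (q - m)) * powInt x m s +
        ∑ i, x i ^ (q + 1) * (s * poleInt x i s) := by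
  have hpole := fun i => (hasDerivAt_poleInt hre i hs0).1
  have hpow : ∀ m : ℕ, m ≤ q →
      IntegrableOn (fun t : ℝ => (t : ℂ) ^ m * exp (-s * logSum x t)) (Ioi 0) := fun m hm =>
    (hasDerivAt_powInt hre (lt_of_le_of_lt (by gcongr) hs)).1
  have h1 := ((hpow q le_rfl).integrable.const_mul (q + 1 - n * s))
  have h2 : ∀ m : Fin q, Integrable (fun t : ℝ => (∑ i, x i ^ (q - m)) *
      ((t : ℂ) ^ (m : ℕ) * exp (-s * logSum x t))) (volume.restrict (Ioi 0)) :=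
    fun m => (hpow m m.2.le).integrable.const_mul _
  have h3 : ∀ i, Integrable (fun t : ℝ => x i ^ (q + 1) *
      (1 / ((t : ℂ) - x i) * exp (-s * logSum x t))) (volume.restrict (Ioi 0)) :=
    fun i => (hpole i).integrable.const_mul _
  have h2' := (integrable_finsetSum Finset.univ fun m _ => h2 m).const_mul s
  have h3' := (integrable_finsetSum Finset.univ fun i _ => h3 i).const_mul s
  have hd : ∀ t ∈ Ici (0 : ℝ), HasDerivAt (fun t : ℝ => (t : ℂ) ^ (q + 1) * exp (-s * logSum x t))
      ((q + 1 - n * s) * ((t : ℂ) ^ q * exp (-s * logSum x t))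
        - s * ∑ m : Fin q, (∑ i, x i ^ (q - m)) * ((t : ℂ) ^ (m : ℕ) * exp (-s * logSum x t))
        - s * ∑ i, x i ^ (q + 1) * (1 / ((t : ℂ) - x i) * exp (-s * logSum x t))) t := by
    intro t ht
    have hp : HasDerivAt (fun t : ℝ => (t : ℂ) ^ (q + 1)) ((q + 1 : ℕ) * (t : ℂ) ^ q) t := by
      simpa using! (hasDerivAt_id t).ofReal_comp.fun_pow (q + 1)
    refine (hp.mul (hasDerivAt_exp_logSum hre s ht)).congr_deriv ?_
    have hsum : (t : ℂ) ^ (q + 1) * ∑ i, 1 / ((t : ℂ) - x i) = n * (t : ℂ) ^ q +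
        ∑ m : Fin q, (∑ i, x i ^ (q - m)) * (t : ℂ) ^ (m : ℕ) +
        ∑ i, x i ^ (q + 1) * (1 / ((t : ℂ) - x i)) := by
      rw [Finset.mul_sum, Finset.sum_congr rfl fun i _ =>
        pow_div_sub _ _ (ofReal_sub_ne_zero hre i ht) q]
      rw [Finset.sum_add_distrib, Finset.sum_add_distrib, Finset.sum_comm]
      simp [Finset.sum_mul]
    simp only [← mul_assoc, ← Finset.sum_mul]
    simp only [mul_assoc] at hsum ⊢
    push_cast
    linear_combination (-s * exp (-s * logSum x t)) * hsum
  have key := integral_Ioi_of_hasDerivAt_of_tendsto' hd ((h1.sub h2').sub h3')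
    (tendsto_pow_mul_exp_logSum hre (q := q + 1) (by push_cast; exact hs))
  have h12 : Integrable (fun t : ℝ => (q + 1 - n * s) * ((t : ℂ) ^ q * exp (-s * logSum x t))
      - s * ∑ m : Fin q, (∑ i, x i ^ (q - m)) * ((t : ℂ) ^ (m : ℕ) * exp (-s * logSum x t)))
      (volume.restrict (Ioi 0)) := h1.sub h2'
  rw [integral_sub h12 h3', integral_sub h1 h2', integral_const_mul, integral_const_mul,
    integral_const_mul, integral_finsetSum _ fun m _ => h2 m, integral_finsetSum _ fun i _ => h3 i]
    at key
  simp only [integral_const_mul] at key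
  simp only [ofReal_zero, ne_eq, Nat.add_eq_zero_iff, one_ne_zero, and_false, not_false_eq_true,
    zero_pow, zero_mul, sub_zero] at key
  have hlast : ∑ i, x i ^ (q + 1) * (s * poleInt x i s) =
      s * ∑ i, x i ^ (q + 1) * poleInt x i s := by
    rw [Finset.mul_sum]
    exact Finset.sum_congr rfl fun i _ => by ring
  rw [hlast]
  simp only [powInt, poleInt]
  linear_combination key

theorem powInt_eq_reduction (hre : ∀ i, (x i).re < 0) {s : ℂ} (q : ℕ) (hs : q + 1 < n * s.re)
    (hs0 : 0 < s.re) :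
    powInt x q s = reduction x s (fun i => s * poleInt x i s) q := by
  induction q using Nat.strong_induction_on with
  | _ q ih =>
    have hne : (q : ℂ) + 1 - n * s ≠ 0 := by
      intro h
      have := congrArg Complex.re h
      simp at this
      linarith
    rw [reduction, eq_div_iff hne, mul_comm, mul_powInt hre hs hs0]
    congr 2
    refine Finset.sum_congr rfl fun m _ => ?_
    have hm : (m : ℝ) ≤ q := by exact_mod_cast m.2.le
    rw [ih m m.2 (by linarith)]

/-- The coefficients of `∏_{j ≠ i} (X − xⱼ)`. -/
noncomputable def cofactorCoeff (x : Fin n → ℂ) (i : Fin n) (k : ℕ) : ℂ :=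
  (∏ j ∈ Finset.univ.erase i, (Polynomial.X - Polynomial.C (x j))).coeff k

theorem sum_cofactorCoeff (x : Fin n → ℂ) (i : Fin n) (a : ℂ) :
    ∑ k ∈ Finset.range n, cofactorCoeff x i k * a ^ k = ∏ j ∈ Finset.univ.erase i, (a - x j) := by
  have hdeg : (∏ j ∈ Finset.univ.erase i,
      (Polynomial.X - Polynomial.C (x j))).natDegree < n := by
    rw [Polynomial.natDegree_finsetProd_X_sub_C_eq_card,
      Finset.card_erase_of_mem (Finset.mem_univ i), Finset.card_univ, Fintype.card_fin]
    exact Nat.sub_lt i.pos one_pos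
  simp only [cofactorCoeff]
  rw [← Polynomial.eval_eq_sum_range' hdeg, Polynomial.eval_prod]
  simp

theorem poleInt_eq_sum_powInt (hre : ∀ i, (x i).re < 0) (i : Fin n) {s : ℂ} (hs : 0 < s.re) :
    poleInt x i s = ∑ k ∈ Finset.range n, cofactorCoeff x i k * powInt x k (s + 1) := by
  have hn : (0 : ℝ) < n := by exact_mod_cast i.pos
  have hint : ∀ k ∈ Finset.range n, Integrable (fun t : ℝ => cofactorCoeff x i k *
      ((t : ℂ) ^ k * exp (-(s + 1) * logSum x t))) (volume.restrict (Ioi 0)) := by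
    intro k hk
    refine ((hasDerivAt_powInt hre ?_).1).integrable.const_mul _
    have : ((k + 1 : ℕ) : ℝ) ≤ n := by exact_mod_cast Finset.mem_range.1 hk
    push_cast at this
    simp only [add_re, one_re]
    nlinarith
  simp only [powInt, ← integral_const_mul]
  rw [← integral_finsetSum _ hint, poleInt]
  refine setIntegral_congr_fun measurableSet_Ioi fun t ht => ?_
  have ht0 : (0 : ℝ) ≤ t := le_of_lt ht
  have h1 := sum_cofactorCoeff x i t
  have h2 := exp_logSum hre ht0
  rw [← Finset.mul_prod_erase _ _ (Finset.mem_univ i), ← h1] at h2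
  have h3 : exp (-s * logSum x t) = exp (-(s + 1) * logSum x t) * exp (logSum x t) := by
    rw [← exp_add]; ring_nf
  simp only [h3, h2, ← mul_assoc, ← Finset.sum_mul]
  have := ofReal_sub_ne_zero hre i ht0
  field_simp

theorem mul_poleInt_const {a : ℂ} (ha : a.re < 0) (i : Fin n) {s : ℂ} (hs : 0 < s.re) :
    s * poleInt (fun _ : Fin n => a) i s = exp (-s * (n * log (-a))) / n := by
  have hn : (n : ℂ) ≠ 0 := by exact_mod_cast i.pos.ne'
  have h := mul_sum_poleInt (x := fun _ : Fin n => a) (fun _ => ha) i.pos hs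
  have h1 : ∀ j : Fin n, poleInt (fun _ : Fin n => a) j s = poleInt (fun _ : Fin n => a) i s :=
    fun _ => rfl
  simp only [h1, logSum, Finset.sum_const, Finset.card_univ, Fintype.card_fin, nsmul_eq_mul,
    ofReal_zero, zero_sub] at h
  rw [← h]
  field_simp

theorem norm_exp_sub_one_le_mul_exp (z : ℂ) : ‖exp z - 1‖ ≤ ‖z‖ * Real.exp ‖z‖ := by
  simpa using norm_exp_sub_sum_le_norm_mul_exp z 1

theorem exists_norm_poleInt_sub_le (hre : ∀ i, (x i).re < 0) (i : Fin n) :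
    ∃ K : ℝ, ∀ s : ℂ, 0 < s.re → ‖s‖ ≤ 1 →
      ‖poleInt x i s - poleInt (fun _ : Fin n => x i) i s‖ ≤ K * ‖s‖ := by
  obtain ⟨c, hc, -, hcx⟩ := exists_le_re_sub hre
  obtain ⟨C, hC, -, hCi⟩ := exists_norm_logSum_sub_le hre
  have hrei : ∀ _ : Fin n, (x i).re < 0 := fun _ => hre i
  obtain ⟨C', hC', hCx', -⟩ := exists_norm_logSum_sub_le hrei
  have hint : IntegrableOn (fun t : ℝ => (1 + t) ^ (-2 : ℝ)) (Ioi 0) := by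
    simpa only [add_comm] using
      integrableOn_add_rpow_Ioi_of_lt (a := -2) (m := 1) (c := 0) (by norm_num) (by norm_num)
  refine ⟨c⁻¹ * (Real.exp C' * (C * Real.exp C)) * ∫ t in Ioi (0 : ℝ), (1 + t) ^ (-2 : ℝ),
    fun s hs hs1 => ?_⟩
  rw [poleInt, poleInt, ← integral_sub (hasDerivAt_poleInt hre i hs).1
    (hasDerivAt_poleInt hrei i hs).1, mul_right_comm, ← integral_const_mul]
  refine norm_integral_le_of_norm_le (hint.integrable.const_mul _) ?_
  filter_upwards [ae_restrict_mem measurableSet_Ioi] with t ht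
  have ht0 : (0 : ℝ) < t := ht
  have h1 : 0 < 1 + t := by linarith
  set L := logSum x t
  set L' := logSum (fun _ : Fin n => x i) t with hL'
  have hLL : ‖L - L'‖ ≤ C / (1 + t) := by
    have := hCi i t ht0.le
    simpa [hL', logSum] using! this
  have hLL1 : ‖L - L'‖ ≤ C := hLL.trans (div_le_self hC (by linarith))
  have hE' : ‖exp (-s * L')‖ ≤ Real.exp C' := by
    refine (norm_exp_neg_mul_le (N := n) hC' ht0.le (by simpa using hCx' t ht0.le) s).trans ?_
    refine (mul_le_of_le_one_right (Real.exp_pos _).le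
      (Real.rpow_le_one_of_one_le_of_nonpos (by linarith) ?_)).trans ?_
    · have : 0 ≤ (n : ℝ) * s.re := by positivity
      linarith
    · exact Real.exp_le_exp.2 (mul_le_of_le_one_left hC' hs1)
  have hD : ‖exp (-s * (L - L')) - 1‖ ≤ ‖s‖ * (C / (1 + t)) * Real.exp C := by
    refine (norm_exp_sub_one_le_mul_exp _).trans ?_
    rw [norm_mul, norm_neg]
    gcongr
    exact (mul_le_of_le_one_left (norm_nonneg _) hs1).trans hLL1
  have hsplit : 1 / ((t : ℂ) - x i) * exp (-s * L) - 1 / ((t : ℂ) - x i) * exp (-s * L') =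
      1 / ((t : ℂ) - x i) * (exp (-s * L') * (exp (-s * (L - L')) - 1)) := by
    rw [mul_sub, ← exp_add]
    ring_nf
  rw [hsplit, norm_mul, norm_mul]
  calc _ ≤ (c⁻¹ * (1 + t) ^ (-1 : ℝ)) *
        (Real.exp C' * (‖s‖ * (C / (1 + t)) * Real.exp C)) := by
        gcongr
        exact norm_one_div_sub_le hc ht0.le (hcx i t ht0.le)
    _ = _ := by
        rw [show (-2 : ℝ) = -1 + -1 by norm_num, Real.rpow_add h1, Real.rpow_neg_one]
        ring

/-- The function `s * poleInt x i s`, with its limit `1 / n` as value at `0`. -/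
noncomputable def poleIntMul (x : Fin n → ℂ) (s : ℂ) (i : Fin n) : ℂ :=
  if s = 0 then 1 / n else s * poleInt x i s

theorem hasDerivWithinAt_poleIntMul (hre : ∀ i, (x i).re < 0) (i : Fin n) :
    HasDerivWithinAt (fun s => poleIntMul x s i) (-log (-x i)) {s | 0 < s.re} 0 := by
  obtain ⟨K, hK⟩ := exists_norm_poleInt_sub_le hre i
  have hn : (n : ℂ) ≠ 0 := by exact_mod_cast i.pos.ne'
  have h0 : (0 : ℂ) ∉ {s : ℂ | 0 < s.re} := by simp
  have hne : ∀ s : ℂ, 0 < s.re → s ≠ 0 := by rintro s hs rfl; simp at hs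
  set D : ℂ → ℂ := fun s => poleInt x i s - poleInt (fun _ : Fin n => x i) i s
  have hD : HasDerivWithinAt (fun s => s * if s = 0 then 0 else D s) 0 {s | 0 < s.re} 0 := by
    rw [hasDerivWithinAt_iff_tendsto_slope' h0]
    have h1 : Tendsto (fun s : ℂ => K * ‖s‖) (𝓝[{s | 0 < s.re}] 0) (𝓝 0) := by
      have : Tendsto (fun s : ℂ => K * ‖s‖) (𝓝 0) (𝓝 (K * ‖(0 : ℂ)‖)) :=
        (continuous_const.mul continuous_norm).tendsto 0
      rw [norm_zero, mul_zero] at this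
      exact this.mono_left nhdsWithin_le_nhds
    refine squeeze_zero_norm' ?_ h1
    filter_upwards [self_mem_nhdsWithin, mem_nhdsWithin_of_mem_nhds
      (Metric.closedBall_mem_nhds (0 : ℂ) one_pos)] with s hs hs1
    have hs0 := hne s hs
    simp only [slope_def_field, hs0, if_false, if_true, zero_mul, sub_zero]
    rw [mul_div_cancel_left₀ _ hs0]
    exact hK s hs (by simpa using hs1)
  have hE : HasDerivWithinAt (fun s => exp (-s * (n * log (-x i))) / n) (-log (-x i))
      {s | 0 < s.re} 0 := by
    have h1 : HasDerivAt (fun s : ℂ => exp (-s * (n * log (-x i))) / n)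
        (exp (-0 * (n * log (-x i))) * (-1 * (n * log (-x i))) / n) 0 :=
      (((hasDerivAt_id (0 : ℂ)).neg.mul_const (n * log (-x i))).cexp).div_const _
    refine (h1.congr_deriv ?_).hasDerivWithinAt
    simp
    field_simp
  refine ((hE.add hD).congr (fun s hs => ?_) (by simp [poleIntMul])).congr_deriv (add_zero _)
  have hs0 := hne s hs
  simp only [poleIntMul, hs0, if_false, Pi.add_apply, D]
  rw [← mul_poleInt_const (hre i) i hs]
  ring

theorem reduction_zero (x : Fin n → ℂ) (E : Fin n → ℂ) (q : ℕ) :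
    reduction x 0 E q = (∑ i, x i ^ (q + 1) * E i) / (q + 1) := by
  rw [reduction]
  simp

theorem reduction_poleIntMul_zero (x : Fin n → ℂ) (q : ℕ) :
    reduction x 0 (poleIntMul x 0) q = (∑ i, x i ^ (q + 1)) / (n * (q + 1)) := by
  rw [reduction_zero]
  simp only [poleIntMul, if_true, ← Finset.sum_mul]
  rw [mul_one_div, div_div]

theorem hasDerivWithinAt_reduction (hre : ∀ i, (x i).re < 0) (q : ℕ) :
    HasDerivWithinAt (fun s => reduction x s (poleIntMul x s) q)
      ((∑ m : Fin q, (∑ i, x i ^ (q - m)) * ((∑ i, x i ^ ((m : ℕ) + 1)) / (n * (m + 1)))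
        - ∑ i, x i ^ (q + 1) * log (-x i)) / (q + 1) + (∑ i, x i ^ (q + 1)) / (q + 1) ^ 2)
      {s | 0 < s.re} 0 := by
  induction q using Nat.strong_induction_on with
  | _ q ih =>
    rcases Nat.eq_zero_or_pos n with hn | hn
    · subst hn
      have : (fun s => reduction x s (poleIntMul x s) q) = fun _ => 0 := by
        funext s
        rw [reduction]
        simp
      rw [this]
      simpa using hasDerivWithinAt_const (0 : ℂ) {s : ℂ | 0 < s.re} (0 : ℂ)
    have hn' : (n : ℂ) ≠ 0 := by exact_mod_cast hn.ne'
    have hq : (q : ℂ) + 1 ≠ 0 := by exact_mod_cast q.succ_ne_zero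
    have h1 : HasDerivWithinAt (fun s => ∑ m : Fin q, (∑ i, x i ^ (q - m)) *
        reduction x s (poleIntMul x s) m) _ {s | 0 < s.re} 0 :=
      HasDerivWithinAt.fun_sum fun m _ => (ih m m.2).const_mul _
    have h2 : HasDerivWithinAt (fun s => ∑ i, x i ^ (q + 1) * poleIntMul x s i) _
        {s | 0 < s.re} 0 :=
      HasDerivWithinAt.fun_sum fun i _ => (hasDerivWithinAt_poleIntMul hre i).const_mul _
    have h3 : HasDerivWithinAt (fun s : ℂ => (q + 1 - n * s : ℂ)) (-(n * 1)) {s | 0 < s.re} 0 :=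
      (((hasDerivAt_id (0 : ℂ)).const_mul (n : ℂ)).const_sub (q + 1 : ℂ)).hasDerivWithinAt
    have h4 := (((hasDerivWithinAt_id (0 : ℂ) {s : ℂ | 0 < s.re}).mul h1).add h2).div h3
      (by simpa using hq)
    have hfun : (fun s => reduction x s (poleIntMul x s) q) = _ := funext fun s => by
      rw [reduction]
    rw [hfun]
    refine h4.congr_deriv ?_
    simp only [id, Pi.add_apply, Pi.mul_apply, zero_mul, one_mul, mul_zero, sub_zero, zero_add,
      add_zero, mul_neg, Finset.sum_neg_distrib, reduction_poleIntMul_zero]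
    simp only [poleIntMul, if_true, ← Finset.sum_mul]
    field_simp
    ring

theorem meromorphicAt_reduction (x : Fin n → ℂ) {E : ℂ → Fin n → ℂ} {z : ℂ}
    (hE : ∀ i, MeromorphicAt (fun s => E s i) z) (q : ℕ) :
    MeromorphicAt (fun s => reduction x s (E s) q) z := by
  induction q using Nat.strong_induction_on with
  | _ q ih =>
    have hfun : (fun s => reduction x s (E s) q) = _ := funext fun s => by rw [reduction]
    rw [hfun]
    have h1 : MeromorphicAt (fun s => ∑ m : Fin q, (∑ i, x i ^ (q - m)) *
        reduction x s (E s) m) z := by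
      refine MeromorphicAt.fun_sum fun m _ => ?_
      exact (MeromorphicAt.const _ _).mul (ih m m.2)
    have h2 : MeromorphicAt (fun s => ∑ i, x i ^ (q + 1) * E s i) z := by
      refine MeromorphicAt.fun_sum fun i _ => ?_
      exact (MeromorphicAt.const _ _).mul (hE i)
    have h3 : AnalyticAt ℂ (fun s : ℂ => (q + 1 - n * s : ℂ)) z := by fun_prop
    exact (((MeromorphicAt.id z).mul h1).add h2).div h3.meromorphicAt

/-- The continuation of `s * poleInt x i s` to `Re s > −N`, by means of the shift `s ↦ s + 1`. -/
noncomputable def poleCont (x : Fin n → ℂ) : ℕ → ℂ → Fin n → ℂ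
  | 0, s, i => s * poleInt x i s
  | N + 1, s, i => s * ∑ k ∈ Finset.range n,
      cofactorCoeff x i k * reduction x (s + 1) (poleCont x N (s + 1)) k

theorem meromorphicAt_poleCont (hre : ∀ i, (x i).re < 0) (N : ℕ) (i : Fin n) {z : ℂ}
    (hz : -(N : ℝ) < z.re) : MeromorphicAt (fun s => poleCont x N s i) z := by
  induction N generalizing i z with
  | zero =>
    have hopen : IsOpen {s : ℂ | 0 < s.re} := isOpen_lt continuous_const continuous_re
    have hd : DifferentiableOn ℂ (poleInt x i) {s : ℂ | 0 < s.re} := fun s hs =>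
      (hasDerivAt_poleInt hre i hs).2.differentiableWithinAt
    have hz' : z ∈ {s : ℂ | 0 < s.re} := by simpa using hz
    exact (MeromorphicAt.id z).mul (hd.analyticAt (hopen.mem_nhds hz')).meromorphicAt
  | succ N ih =>
    have hshift : AnalyticAt ℂ (fun s : ℂ => s + 1) z := by fun_prop
    have hz' : -(N : ℝ) < (z + 1).re := by
      push_cast at hz
      simp only [add_re, one_re]
      linarith
    have hsum : MeromorphicAt (fun s => ∑ k ∈ Finset.range n,
        cofactorCoeff x i k * reduction x (s + 1) (poleCont x N (s + 1)) k) z := by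
      refine MeromorphicAt.fun_sum fun k _ => (MeromorphicAt.const _ _).mul ?_
      exact MeromorphicAt.comp_analyticAt (g := fun s : ℂ => s + 1)
        (meromorphicAt_reduction x (fun i => ih i hz') k) hshift
    exact (MeromorphicAt.id z).mul hsum

theorem poleCont_succ (hre : ∀ i, (x i).re < 0) (N : ℕ) {s : ℂ} (hs : -(N : ℝ) < s.re) :
    poleCont x (N + 1) s = poleCont x N s := by
  induction N generalizing s with
  | zero =>
    have hs0 : 0 < s.re := by simpa using hs
    funext i
    have hn : (0 : ℝ) < n := by exact_mod_cast i.pos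
    simp only [poleCont]
    rw [poleInt_eq_sum_powInt hre i hs0]
    congr 1
    refine Finset.sum_congr rfl fun k hk => ?_
    have hk' : ((k + 1 : ℕ) : ℝ) ≤ n := by exact_mod_cast Finset.mem_range.1 hk
    push_cast at hk'
    rw [powInt_eq_reduction hre k (by simp only [add_re, one_re]; nlinarith)
      (by simp only [add_re, one_re]; linarith)]
  | succ N ih =>
    have hs' : -(N : ℝ) < (s + 1).re := by
      push_cast at hs
      simp only [add_re, one_re]
      linarith
    funext i
    rw [poleCont, ih hs', poleCont]

theorem poleCont_eq_of_le (hre : ∀ i, (x i).re < 0) {N N' : ℕ} (h : N ≤ N') {s : ℂ}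
    (hs : -(N : ℝ) < s.re) : poleCont x N' s = poleCont x N s := by
  induction N', h using Nat.le_induction with
  | base => rfl
  | succ N' h ih =>
    have : (N : ℝ) ≤ N' := by exact_mod_cast h
    rw [poleCont_succ hre N' (by linarith), ih]

/-- The meromorphic continuation of `powInt x q` to the complex plane. -/
noncomputable def powCont (x : Fin n → ℂ) (q : ℕ) (s : ℂ) : ℂ :=
  reduction x s (poleCont x (⌈-s.re⌉₊ + 1) s) q

theorem powCont_eq (hre : ∀ i, (x i).re < 0) (q : ℕ) {N : ℕ} {s : ℂ} (hs : -(N : ℝ) < s.re) :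
    powCont x q s = reduction x s (poleCont x N s) q := by
  have h1 : -((⌈-s.re⌉₊ + 1 : ℕ) : ℝ) < s.re := by
    have := Nat.le_ceil (-s.re)
    push_cast
    linarith
  rw [powCont]
  rcases le_total N (⌈-s.re⌉₊ + 1) with h | h
  · rw [poleCont_eq_of_le hre h hs]
  · rw [poleCont_eq_of_le hre h h1]

theorem meromorphicAt_powCont (hre : ∀ i, (x i).re < 0) (q : ℕ) (z : ℂ) :
    MeromorphicAt (powCont x q) z := by
  obtain ⟨N, hN⟩ := exists_nat_gt (-z.re)
  have hz : -(N : ℝ) < z.re := by linarith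
  refine (meromorphicAt_reduction x (fun i => meromorphicAt_poleCont hre N i hz) q).congr
    (eventually_nhdsWithin_of_eventually_nhds ?_)
  filter_upwards [(isOpen_lt continuous_const continuous_re).mem_nhds
    (show z ∈ {s : ℂ | -(N : ℝ) < s.re} from hz)] with s hs
  exact (powCont_eq hre q hs).symm

theorem powCont_eq_powInt (hre : ∀ i, (x i).re < 0) {q : ℕ} {s : ℂ} (hs : q + 1 < n * s.re)
    (hs0 : 0 < s.re) : powCont x q s = powInt x q s := by
  rw [powCont_eq hre q (N := 0) (by simpa using hs0), powInt_eq_reduction hre q hs hs0]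
  rfl

theorem powCont_eqOn (hre : ∀ i, (x i).re < 0) (q : ℕ) :
    EqOn (powCont x q) (fun s => reduction x s (poleIntMul x s) q) {s | 0 < s.re} := by
  intro s hs
  have hs0 : s ≠ 0 := by rintro rfl; simp at hs
  rw [powCont_eq hre q (N := 0) (by simpa using hs)]
  congr 1
  funext i
  simp [poleCont, poleIntMul, hs0]

theorem logSum_const_one (a : ℂ) (t : ℝ) : logSum (fun _ : Fin 1 => a) t = log ((t : ℂ) - a) := by
  simp [logSum]

theorem integrableOn_lemmaTwoIntegrand_and_hasDerivAt (hn : 1 ≤ n) (hre : ∀ i, (x i).re < 0)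
    (p : ℕ) {s : ℂ} (hs : (p : ℝ) + 1 < s.re) :
    IntegrableOn (lemmaTwoIntegrand n x p s) (Ioi 0) ∧
    HasDerivAt (fun s => powCont x p s - ∑ i, powCont (fun _ : Fin 1 => x i) p s)
      (-lemmaTwoF n x p s) s := by
  have hn' : (1 : ℝ) ≤ n := by exact_mod_cast hn
  have hp : (0 : ℝ) ≤ p := p.cast_nonneg
  have hrei : ∀ i, ∀ _ : Fin 1, (x i).re < 0 := fun i _ => hre i
  have hsn : ∀ u : ℂ, (p : ℝ) + 1 < u.re → (p : ℝ) + 1 < n * u.re := fun u hu => by nlinarith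
  have hs1 : ∀ u : ℂ, (p : ℝ) + 1 < u.re → (p : ℝ) + 1 < (1 : ℕ) * u.re := fun u hu => by
    simpa using hu
  obtain ⟨-, hI, hd⟩ := hasDerivAt_powInt hre (hsn s hs)
  have hI1 := fun i => (hasDerivAt_powInt (hrei i) (hs1 s hs)).2.1
  have hd1 := fun i => (hasDerivAt_powInt (hrei i) (hs1 s hs)).2.2
  have hsum := integrable_finsetSum Finset.univ fun i _ => (hI1 i).integrable
  have hfun : lemmaTwoIntegrand n x p s = fun t : ℝ =>
      (t : ℂ) ^ p * (logSum x t * exp (-s * logSum x t)) - ∑ i, (t : ℂ) ^ p *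
        (logSum (fun _ : Fin 1 => x i) t * exp (-s * logSum (fun _ : Fin 1 => x i) t)) := by
    funext t
    simp only [logSum_const_one, ← Finset.mul_sum]
    rw [← mul_sub]
    rfl
  refine ⟨hfun ▸ hI.integrable.sub hsum, ?_⟩
  have hF : lemmaTwoF n x p s =
      (∫ t in Ioi (0 : ℝ), (t : ℂ) ^ p * (logSum x t * exp (-s * logSum x t))) -
      ∑ i, ∫ t in Ioi (0 : ℝ), (t : ℂ) ^ p *
        (logSum (fun _ : Fin 1 => x i) t * exp (-s * logSum (fun _ : Fin 1 => x i) t)) := by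
    rw [lemmaTwoF, hfun, integral_sub hI hsum, integral_finsetSum _ fun i _ => (hI1 i).integrable]
  have key := hd.sub (HasDerivAt.fun_sum (u := Finset.univ) fun i _ => hd1 i)
  rw [Finset.sum_neg_distrib] at key
  rw [hF, neg_sub', sub_neg_eq_add]
  rw [sub_neg_eq_add] at key
  refine key.congr_of_eventuallyEq ?_
  filter_upwards [(isOpen_lt continuous_const continuous_re).mem_nhds
    (show s ∈ {u : ℂ | (p : ℝ) + 1 < u.re} from hs)] with u hu
  have hu' : (p : ℝ) + 1 < u.re := hu
  have hu0 : 0 < u.re := by linarith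
  simp only [Pi.sub_apply]
  rw [powCont_eq_powInt hre (hsn u hu) hu0]
  congr 1
  exact Finset.sum_congr rfl fun i _ => powCont_eq_powInt (hrei i) (hs1 u hu) hu0

theorem two_mul_sum_div (a : ℕ → ℂ) (p : ℕ) :
    2 * ∑ m : Fin p, a (p - m) * a ((m : ℕ) + 1) / ((m : ℂ) + 1) =
      (p + 1) * ∑ l ∈ Finset.Icc 1 p,
        (1 / ((l : ℂ) * ((p : ℂ) + 1 - (l : ℂ)))) * a l * a (p - l + 1) := by
  have hIcc : ∑ l ∈ Finset.Icc 1 p, (1 / ((l : ℂ) * ((p : ℂ) + 1 - (l : ℂ)))) * a l * a (p - l + 1)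
      = ∑ m ∈ Finset.range p, 1 / (((m : ℂ) + 1) * ((p : ℂ) - m)) * a (m + 1) * a (p - m) := by
    rw [← Finset.Ico_add_one_right_eq_Icc, Finset.sum_Ico_eq_sum_range]
    refine Finset.sum_congr (by simp) fun m hm => ?_
    have hm' : m < p := by simpa using hm
    rw [show p - (1 + m) + 1 = p - m by omega, add_comm 1 m]
    push_cast
    ring_nf
  rw [hIcc, ← Finset.sum_range fun m => a (p - m) * a (m + 1) / ((m : ℂ) + 1), two_mul]
  nth_rewrite 2 [← Finset.sum_range_reflect]
  rw [← Finset.sum_add_distrib, Finset.mul_sum]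
  refine Finset.sum_congr rfl fun m hm => ?_
  have hm' : m < p := Finset.mem_range.1 hm
  have h1 : ((p - 1 - m : ℕ) : ℂ) + 1 = p - m := by
    have : p - 1 - m + 1 = p - m := by omega
    rw [← Nat.cast_sub hm'.le, ← this]
    push_cast
    ring
  rw [h1, show p - (p - 1 - m) = m + 1 by omega, show p - 1 - m + 1 = p - m by omega]
  have h2 : (m : ℂ) + 1 ≠ 0 := by exact_mod_cast m.succ_ne_zero
  have h3 : (p : ℂ) - m ≠ 0 := sub_ne_zero.2 (by exact_mod_cast hm'.ne')
  field_simp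
  ring

/-- The limit at `0` of minus the derivative of the difference of continued integrals. -/
theorem tendsto_deriv_powCont_sub (hn : 1 ≤ n) (hre : ∀ i, (x i).re < 0) (p : ℕ) :
    Tendsto (fun s => -deriv (fun s => powCont x p s - ∑ i, powCont (fun _ : Fin 1 => x i) p s) s)
      (𝓝[≠] 0) (𝓝 (-(1 / (2 * (n : ℂ))) *
            (∑ l ∈ Finset.Icc 1 p, (1 / ((l : ℂ) * ((p : ℂ) + 1 - (l : ℂ)))) *
              (∑ i : Fin n, x i ^ l) * (∑ j : Fin n, x j ^ (p - l + 1)))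
          + (((∑ i ∈ Finset.Icc 1 p, (1 : ℝ) / i : ℝ) : ℂ) / ((p : ℂ) + 1)) *
              ∑ i : Fin n, x i ^ (p + 1))) := by
  have hrei : ∀ i, ∀ _ : Fin 1, (x i).re < 0 := fun i _ => hre i
  have hn' : (n : ℂ) ≠ 0 := by exact_mod_cast (by omega : n ≠ 0)
  have hp : (p : ℂ) + 1 ≠ 0 := by exact_mod_cast p.succ_ne_zero
  have hmer : MeromorphicAt
      (fun s => powCont x p s - ∑ i, powCont (fun _ : Fin 1 => x i) p s) 0 :=
    (meromorphicAt_powCont hre p 0).sub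
      (MeromorphicAt.fun_sum fun i _ => meromorphicAt_powCont (hrei i) p 0)
  have hd := (hasDerivWithinAt_reduction hre p).sub
    (HasDerivWithinAt.fun_sum (u := Finset.univ) fun i _ =>
      hasDerivWithinAt_reduction (hrei i) p)
  have key := (tendsto_deriv_of_hasDerivWithinAt hmer (fun s hs => by
    simp only [Pi.sub_apply]
    rw [powCont_eqOn hre p hs]
    congr 1
    exact Finset.sum_congr rfl fun i _ => powCont_eqOn (hrei i) p hs) hd).neg
  convert! key using 2
  have h2 := two_mul_sum_div (fun k => ∑ i, x i ^ k) p
  have hH : (((∑ i ∈ Finset.Icc 1 p, (1 : ℝ) / i : ℝ) : ℂ)) = ∑ m : Fin p, 1 / ((m : ℂ) + 1) := by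
    rw [← Finset.sum_range fun m => 1 / ((m : ℂ) + 1), ← Finset.Ico_add_one_right_eq_Icc,
      Finset.sum_Ico_eq_sum_range]
    push_cast
    simp [add_comm]
  have h3 : ∀ i : Fin n, ∑ m : Fin p, x i ^ (p - m) * (x i ^ ((m : ℕ) + 1) / (m + 1)) =
      x i ^ (p + 1) * ∑ m : Fin p, 1 / ((m : ℂ) + 1) := by
    intro i
    rw [Finset.mul_sum]
    refine Finset.sum_congr rfl fun m _ => ?_
    have hm := m.2
    rw [← mul_div_assoc, ← pow_add, show p - m + ((m : ℕ) + 1) = p + 1 by omega, mul_one_div]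
  have h4 : ∑ m : Fin p, (∑ i, x i ^ (p - m)) * ((∑ i, x i ^ ((m : ℕ) + 1)) / (n * (m + 1))) =
      (∑ m : Fin p, (∑ i, x i ^ (p - m)) * (∑ i, x i ^ ((m : ℕ) + 1)) / ((m : ℂ) + 1)) / n := by
    rw [Finset.sum_div]
    refine Finset.sum_congr rfl fun m _ => ?_
    rw [mul_comm (n : ℂ), ← div_div]
    ring
  rw [h4, hH]
  simp only [Finset.univ_unique, Finset.sum_singleton, Nat.cast_one, one_mul, h3,
    Finset.sum_add_distrib, ← Finset.sum_div, Finset.sum_sub_distrib, ← Finset.sum_mul]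
  beta_reduce at h2
  generalize ∑ l ∈ Finset.Icc 1 p, (1 / ((l : ℂ) * ((p : ℂ) + 1 - (l : ℂ)))) *
    (∑ i : Fin n, x i ^ l) * (∑ j : Fin n, x j ^ (p - l + 1)) = A at h2 ⊢
  field_simp
  linear_combination (p + 1 : ℂ) * h2

end

end

/-- Lemma 2: `F⁽ᵖ⁾` converges for `Re s > p + 1`, extends holomorphically to `0`, and every
holomorphic extension `G` to an open connected set containing `0` and `{s : Re s > p + 1}`
satisfies
`G(0) = −(1/(2n)) Σ_{l=1}^p [ (1/(l(p+1−l))) (Σᵢ xᵢˡ)(Σⱼ xⱼ^{p−l+1}) ]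
        + (H_p/(p+1)) Σᵢ xᵢ^{p+1}`, with `H_p` the `p`-th harmonic number. -/
theorem lemma_two
    (n : ℕ) (hn : 1 ≤ n) (x : Fin n → ℂ) (hre : ∀ i, (x i).re < 0) (p : ℕ) :
    (∀ s : ℂ, (p : ℝ) + 1 < s.re →
        MeasureTheory.IntegrableOn (lemmaTwoIntegrand n x p s) (Set.Ioi 0)) ∧
    (∃ U : Set ℂ, ∃ G : ℂ → ℂ, IsOpen U ∧ IsConnected U ∧ (0 : ℂ) ∈ U ∧
        {s : ℂ | (p : ℝ) + 1 < s.re} ⊆ U ∧ DifferentiableOn ℂ G U ∧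
        ∀ s : ℂ, (p : ℝ) + 1 < s.re → G s = lemmaTwoF n x p s) ∧
    (∀ U : Set ℂ, ∀ G : ℂ → ℂ, IsOpen U → IsConnected U → (0 : ℂ) ∈ U →
        {s : ℂ | (p : ℝ) + 1 < s.re} ⊆ U → DifferentiableOn ℂ G U →
        (∀ s : ℂ, (p : ℝ) + 1 < s.re → G s = lemmaTwoF n x p s) →
        G 0 = -(1 / (2 * (n : ℂ))) *
            (∑ l ∈ Finset.Icc 1 p, (1 / ((l : ℂ) * ((p : ℂ) + 1 - (l : ℂ)))) *
              (∑ i : Fin n, x i ^ l) * (∑ j : Fin n, x j ^ (p - l + 1)))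
          + (((∑ i ∈ Finset.Icc 1 p, (1 : ℝ) / i : ℝ) : ℂ) / ((p : ℂ) + 1)) *
              ∑ i : Fin n, x i ^ (p + 1)) := by
  have hmer : ∀ z, MeromorphicAt (fun s =>
      -deriv (fun s => powCont x p s - ∑ i, powCont (fun _ : Fin 1 => x i) p s) s) z := fun z =>
    ((meromorphicAt_powCont hre p z).sub (MeromorphicAt.fun_sum fun i _ =>
      meromorphicAt_powCont (x := fun _ : Fin 1 => x i) (fun _ => hre i) p z)).deriv.neg
  have hlim := tendsto_deriv_powCont_sub hn hre p
  have hF : ∀ s : ℂ, (p : ℝ) + 1 < s.re →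
      -deriv (fun s => powCont x p s - ∑ i, powCont (fun _ : Fin 1 => x i) p s) s =
        lemmaTwoF n x p s := fun s hs => by
    rw [(integrableOn_lemmaTwoIntegrand_and_hasDerivAt hn hre p hs).2.deriv, neg_neg]
  refine ⟨fun s hs => (integrableOn_lemmaTwoIntegrand_and_hasDerivAt hn hre p hs).1, ?_, ?_⟩
  · obtain ⟨U, G, hU, hU', h0, hUc, hG, hGM⟩ := meromorphic_extension_exists hmer
      (c := (p : ℝ) + 1) (by positivity) hlim (fun s hs => by
        have hd : DifferentiableOn ℂ
            (fun s => powCont x p s - ∑ i, powCont (fun _ : Fin 1 => x i) p s)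
            {s : ℂ | (p : ℝ) + 1 < s.re} := fun u hu =>
          (integrableOn_lemmaTwoIntegrand_and_hasDerivAt hn hre p
            hu).2.differentiableAt.differentiableWithinAt
        exact (hd.analyticAt ((isOpen_lt continuous_const Complex.continuous_re).mem_nhds
          hs)).deriv.neg.continuousAt)
    exact ⟨U, G, hU, hU', h0, hUc, hG, fun s hs => (hGM s hs).trans (hF s hs)⟩
  · intro U G hU hU' h0 hUc hG hGF
    exact eq_of_meromorphic_extension hmer hlim hU hU' h0 hUc hG
      fun s hs => (hGF s hs).trans (hF s hs).symm
end
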